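/- arXiv:2206.00697 — 5 statements merged into one kernel-verified Lean document; each statement's English description precedes it below -/
import Mathlib

section
/- Let f, g ∈ O(x,y) with f polynomially tamed and g monomially tamed on Σ_n. Assume that for every choice of 1 ≤ n₀ ≤ n, positive rational numbers α^1, …, α^{n₀}, real numbers β^1, …, β^{n₀}, and complex numbers ζ^{n₀+1}, …, ζ^n with positive imaginary part, the bound |f| ≺ |g| holds on the linear test set Σ_n ∩ {(x,y) : α^1 φ^1 + β^1 = ⋯ = α^{n₀} φ^{n₀} + β^{n₀}, φ^{n₀+1} = ζ^{n₀+1}, …, φ^n = ζ^n}, where φ^k = x^k + i y^k. Then |f| ≺ |g| holds on all of Σ_n. -/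
namespace TamePaper

noncomputable section

/-- The point space: `n` pairs of real coordinates `(x, y)`. -/
abbrev Pt (n : ℕ) := (Fin n → ℝ) × (Fin n → ℝ)

/-- The growth sector `Σ_n = {0 < xᵏ < 1, y¹ ≥ y² ≥ ⋯ ≥ yⁿ > 1}`. -/
def GrowthSector (n : ℕ) : Set (Pt n) :=
  {p | (∀ k, 0 < p.1 k ∧ p.1 k < 1) ∧
       (∀ k l : Fin n, k ≤ l → p.2 l ≤ p.2 k) ∧ (∀ k, 1 < p.2 k)}

/-- `f ≺ g` on `S`: there is `C > 0` with `f < C·g` everywhere on `S`. -/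
def Prec {α : Type*} (S : Set α) (f g : α → ℝ) : Prop :=
  ∃ C : ℝ, 0 < C ∧ ∀ p ∈ S, f p < C * g p

/-- `f ∼ g` on `S`: `C₁·g < f < C₂·g` on `S` for two constants of the same sign. -/
def Sim {α : Type*} (S : Set α) (f g : α → ℝ) : Prop :=
  ∃ C₁ C₂ : ℝ, 0 < C₁ * C₂ ∧ ∀ p ∈ S, C₁ * g p < f p ∧ f p < C₂ * g p

/-- The closed unit polydisk in `ℝ^{2n}`. -/
def ClosedPolydisk (n : ℕ) : Set (Fin n → ℝ × ℝ) :=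
  {q | ∀ k, (q k).1 ^ 2 + (q k).2 ^ 2 ≤ 1}

/-- A restricted analytic function: real-analytic on an open neighborhood of the
closed unit polydisk. -/
def RestrictedAnalytic (n : ℕ) (ρ : (Fin n → ℝ × ℝ) → ℝ) : Prop :=
  ∃ U : Set (Fin n → ℝ × ℝ), IsOpen U ∧ ClosedPolydisk n ⊆ U ∧ AnalyticOnNhd ℝ ρ U

/-- The coordinates `uᵏ = e^{-2πyᵏ} cos(2πxᵏ)`, `vᵏ = e^{-2πyᵏ} sin(2πxᵏ)`. -/
def uv (n : ℕ) (p : Pt n) : Fin n → ℝ × ℝ := fun k =>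
  (Real.exp (-(2 * Real.pi * p.2 k)) * Real.cos (2 * Real.pi * p.1 k),
   Real.exp (-(2 * Real.pi * p.2 k)) * Real.sin (2 * Real.pi * p.1 k))

/-- Membership in the ring `O`: on `Σ_n`, `f` is given by a restricted analytic
function of the variables `uᵏ, vᵏ`. -/
def InO (n : ℕ) (f : Pt n → ℝ) : Prop :=
  ∃ ρ, RestrictedAnalytic n ρ ∧ ∀ p ∈ GrowthSector n, f p = ρ (uv n p)

/-- The monomial `(y¹)^{m₁} ⋯ (yⁿ)^{mₙ}`. -/
def monomial (n : ℕ) (m : Fin n → ℤ) : Pt n → ℝ := fun p => ∏ k, p.2 k ^ m k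

/-- Membership in `O[x,y,y⁻¹]`: a finite sum `∑ ρ_{k,m} x^k y^m` with `ρ_{k,m} ∈ O`,
`k ∈ ℕⁿ`, `m ∈ ℤⁿ`. -/
def InOPoly (n : ℕ) (f : Pt n → ℝ) : Prop :=
  ∃ (T : Finset ((Fin n → ℕ) × (Fin n → ℤ)))
    (ρ : ((Fin n → ℕ) × (Fin n → ℤ)) → Pt n → ℝ),
    (∀ km ∈ T, InO n (ρ km)) ∧
    ∀ p ∈ GrowthSector n,
      f p = ∑ km ∈ T, ρ km p * (∏ k, p.1 k ^ km.1 k) * (∏ k, p.2 k ^ km.2 k)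

/-- Membership in `O(x,y)`: a quotient `g/h` with `g, h ∈ O[x,y,y⁻¹]` and `h`
nowhere vanishing on `Σ_n`. -/
def InOFrac (n : ℕ) (f : Pt n → ℝ) : Prop :=
  ∃ g h, InOPoly n g ∧ InOPoly n h ∧ (∀ p ∈ GrowthSector n, h p ≠ 0) ∧
    ∀ p ∈ GrowthSector n, f p = g p / h p

/-- `f` has monomial growth: `f ∼ (y¹)^{m₁}⋯(yⁿ)^{mₙ}` on `Σ_n` for some `m ∈ ℤⁿ`. -/
def MonGrowth (n : ℕ) (f : Pt n → ℝ) : Prop :=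
  ∃ m : Fin n → ℤ, Sim (GrowthSector n) f (monomial n m)

/-- `f` is monomially tamed: `f ∈ O(x,y)` and `f ∼ (y¹)^{m₁}⋯(yⁿ)^{mₙ}` on `Σ_n`. -/
def MonTamed (n : ℕ) (f : Pt n → ℝ) : Prop := InOFrac n f ∧ MonGrowth n f

/-- `f` is polynomially tamed: `f = g/h` with `g ∈ O[x,y,y⁻¹]` and `h` monomially tamed. -/
def PolyTamed (n : ℕ) (f : Pt n → ℝ) : Prop :=
  ∃ g h, InOPoly n g ∧ MonTamed n h ∧ (∀ p ∈ GrowthSector n, h p ≠ 0) ∧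
    ∀ p ∈ GrowthSector n, f p = g p / h p

/-- The linear test set `{α¹φ¹+β¹ = ⋯ = α^{n₀}φ^{n₀}+β^{n₀}, φ^{n₀+1} = ζ^{n₀+1}, …, φⁿ = ζⁿ}`,
where `φᵏ = xᵏ + i yᵏ`. -/
def LinearTestSet (n n₀ : ℕ) (α : Fin n → ℚ) (β : Fin n → ℝ) (ζ : Fin n → ℂ) :
    Set (Pt n) :=
  {p | (∀ k l : Fin n, (k : ℕ) < n₀ → (l : ℕ) < n₀ →
          (α k : ℂ) * ((p.1 k : ℂ) + (p.2 k : ℂ) * Complex.I) + (β k : ℂ)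
            = (α l : ℂ) * ((p.1 l : ℂ) + (p.2 l : ℂ) * Complex.I) + (β l : ℂ)) ∧
       ∀ k : Fin n, n₀ ≤ (k : ℕ) → (p.1 k : ℂ) + (p.2 k : ℂ) * Complex.I = ζ k}

section Helpers

open Polynomial

theorem poly_coeff_bound (S : Set ℝ) (hS : S.Infinite) (K : ℕ) :
    ∃ (s : Finset ℝ) (C : ℝ), (↑s : Set ℝ) ⊆ S ∧ 0 ≤ C ∧
      ∀ (P : ℝ[X]) (M : ℝ), P.degree < K → (∀ x ∈ s, |P.eval x| ≤ M) →
        ∀ k, |P.coeff k| ≤ C * M := by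
  obtain ⟨s, hs, hc⟩ := hS.exists_subset_card_eq K
  refine ⟨s, ∑ x ∈ s, ∑ k ∈ Finset.range K, |(Lagrange.basis s id x).coeff k|, hs,
    by positivity, ?_⟩
  intro P M hP hM k
  by_cases hk : k < K
  swap
  · have h0 : P.coeff k = 0 := by
      apply Polynomial.coeff_eq_zero_of_degree_lt
      refine hP.trans_le ?_
      exact_mod_cast not_lt.mp hk
    rcases s.eq_empty_or_nonempty with h | ⟨x, hx⟩
    · subst h; simp [h0]
    · rw [h0, abs_zero]
      exact mul_nonneg (by positivity) ((abs_nonneg _).trans (hM x hx))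
  have h1 := Lagrange.eq_interpolate (s := s) (v := id) (f := P) (Set.injOn_id _) (by rw [hc]; exact hP)
  have h2 : P.coeff k = ∑ x ∈ s, P.eval x * (Lagrange.basis s id x).coeff k := by
    conv_lhs => rw [h1]
    simp [Lagrange.interpolate_apply]
  rw [h2, Finset.sum_mul]
  refine (Finset.abs_sum_le_sum_abs _ _).trans (Finset.sum_le_sum fun x hx => ?_)
  rw [abs_mul, mul_comm]
  have hM0 := (abs_nonneg _).trans (hM x hx)
  apply mul_le_mul _ (hM x hx) (abs_nonneg _) (by positivity)
  exact Finset.single_le_sum (f := fun k => |(Lagrange.basis s id x).coeff k|) (fun _ _ => abs_nonneg _) (Finset.mem_range.2 hk)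

theorem laurent_bound (J : Finset ℤ) :
    ∃ (s : Finset ℚ) (C : ℝ), (∀ q ∈ s, 1 ≤ q ∧ q ≤ 2) ∧ 0 ≤ C ∧
      ∀ (D : ℤ → ℝ) (M : ℝ), (∀ q ∈ s, |∑ j ∈ J, (q : ℝ) ^ j * D j| ≤ M) →
        ∀ j ∈ J, |D j| ≤ C * M := by
  obtain ⟨N, hN⟩ : ∃ N : ℕ, ∀ j ∈ J, |j| ≤ N := by
    refine ⟨∑ j ∈ J, j.natAbs, fun j hj => ?_⟩
    rw [Int.abs_eq_natAbs]
    exact_mod_cast Finset.single_le_sum (f := fun j : ℤ => j.natAbs) (fun _ _ => Nat.zero_le _) hj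
  have hinf : ((fun q : ℚ => (q : ℝ)) '' Set.Icc 1 2).Infinite :=
    (Set.Icc_infinite (by norm_num)).image (Rat.cast_injective.injOn)
  obtain ⟨s, C, hs, hC, h⟩ := poly_coeff_bound _ hinf (2 * N + 1)
  obtain ⟨t, ht, rfl⟩ := Finset.subset_set_image_iff.mp hs
  refine ⟨t, C * 2 ^ N, fun q hq => ht hq, by positivity, ?_⟩
  intro D M hM j hj
  set P : ℝ[X] := ∑ j ∈ J, Polynomial.C (D j) * X ^ (j + N).toNat with hP
  have hj' : ∀ j ∈ J, 0 ≤ j + N := fun j hj => by have := abs_le.mp (hN j hj); omega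
  have hev : ∀ x : ℝ, 0 < x → P.eval x = x ^ N * ∑ j ∈ J, x ^ j * D j := by
    intro x hx
    rw [hP, Polynomial.eval_finsetSum, Finset.mul_sum]
    refine Finset.sum_congr rfl fun j hj => ?_
    simp only [eval_mul, eval_C, eval_pow, eval_X]
    rw [← zpow_natCast x (j+N).toNat, Int.toNat_of_nonneg (hj' j hj), zpow_add₀ hx.ne', zpow_natCast]
    ring
  have hco : P.coeff (j + N).toNat = D j := by
    rw [hP, Polynomial.finsetSum_coeff, Finset.sum_eq_single j]
    · simp
    · intro i hi hij
      rw [coeff_C_mul, coeff_X_pow, if_neg, mul_zero]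
      intro h
      have := hj' i hi
      have := hj' j hj
      omega
    · intro h; exact absurd hj h
  have hdeg : P.degree < (2 * N + 1 : ℕ) := by
    rw [hP]
    refine (Polynomial.degree_sum_le _ _).trans_lt ?_
    rw [Finset.sup_lt_iff (by exact WithBot.bot_lt_coe _)]
    intro i hi
    refine (Polynomial.degree_C_mul_X_pow_le _ _).trans_lt ?_
    have := abs_le.mp (hN i hi)
    norm_cast
    omega
  have := h P (2 ^ N * M) hdeg (fun x hx => ?_) (j + N).toNat
  · rw [hco] at this; linarith
  · obtain ⟨q, hq, rfl⟩ := Finset.mem_image.mp hx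
    obtain ⟨h1, h2⟩ := ht hq
    have h1' : (1 : ℝ) ≤ q := by exact_mod_cast h1
    have h2' : (q : ℝ) ≤ 2 := by exact_mod_cast h2
    rw [hev _ (by linarith), abs_mul, abs_of_nonneg (by positivity)]
    exact mul_le_mul (pow_le_pow_left₀ (by linarith) h2' _) (hM q hq) (abs_nonneg _) (by positivity)

theorem poly_bound (S : Set ℝ) (hS : S.Infinite) (K : ℕ) (R : ℝ) :
    ∃ (s : Finset ℝ) (C : ℝ), (↑s : Set ℝ) ⊆ S ∧ 0 ≤ C ∧
      ∀ (P : ℝ[X]) (M : ℝ), P.natDegree < K → (∀ x ∈ s, |P.eval x| ≤ M) →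
        ∀ t, |t| ≤ R → |P.eval t| ≤ C * M := by
  obtain ⟨s, C, hs, hC, h⟩ := poly_coeff_bound S hS K
  refine ⟨s, C * ∑ k ∈ Finset.range K, |R| ^ k, hs, by positivity, ?_⟩
  intro P M hPn hM t ht
  have hP : P.degree < K := (Polynomial.degree_le_natDegree).trans_lt (by exact_mod_cast hPn)
  rw [Polynomial.eval_eq_sum_range' (n := K)]
  · rw [mul_assoc, mul_comm _ M, ← mul_assoc, Finset.mul_sum]
    refine (Finset.abs_sum_le_sum_abs _ _).trans (Finset.sum_le_sum fun k _ => ?_)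
    rw [abs_mul, abs_pow]
    exact mul_le_mul (h P M hP hM k) (pow_le_pow_left₀ (abs_nonneg _) (ht.trans (le_abs_self R)) _) (by positivity) ((abs_nonneg _).trans (h P M hP hM k))
  · exact hPn

/-- Tail of a point. -/
def tl {n : ℕ} (p : Pt (n + 1)) : Pt n := (fun k => p.1 k.succ, fun k => p.2 k.succ)

/-- Prepend a coordinate. -/
def cn {n : ℕ} (x y : ℝ) (p : Pt n) : Pt (n + 1) := (Fin.cons x p.1, Fin.cons y p.2)

theorem tl_cn {n : ℕ} (x y : ℝ) (p : Pt n) : tl (cn x y p) = p := rfl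

theorem tl_mem {n : ℕ} {p : Pt (n + 1)} (hp : p ∈ GrowthSector (n + 1)) :
    tl p ∈ GrowthSector n :=
  ⟨fun k => hp.1 k.succ, fun k l h => hp.2.1 k.succ l.succ (Fin.succ_le_succ_iff.mpr h),
    fun k => hp.2.2 k.succ⟩

theorem cn_mem {n : ℕ} {x y : ℝ} {p : Pt n} (hp : p ∈ GrowthSector n) (hx : 0 < x) (hx1 : x < 1)
    (hy : 1 < y) (hyp : ∀ k, p.2 k ≤ y) : cn x y p ∈ GrowthSector (n + 1) := by
  refine ⟨?_, ?_, ?_⟩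
  · intro k
    refine Fin.cases ⟨hx, hx1⟩ (fun i => hp.1 i) k
  · intro k l
    refine Fin.cases ?_ (fun i => ?_) k
    · refine Fin.cases ?_ (fun j => ?_) l
      · intro _; exact le_refl _
      · intro _; exact hyp j
    · refine Fin.cases ?_ (fun j => ?_) l
      · intro h; exact absurd h (by simp)
      · intro h; exact hp.2.1 i j (Fin.succ_le_succ_iff.mp h)
  · intro k
    refine Fin.cases hy (fun i => hp.2.2 i) k

/-- Functions decaying faster than any power of the first `y`. -/
def decaySub (n : ℕ) : Submodule ℝ (Pt (n + 1) → ℝ) where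
  carrier := {E | ∀ N : ℕ, ∃ C : ℝ, ∀ p ∈ GrowthSector (n + 1), |E p| * (p.2 0) ^ N ≤ C}
  add_mem' := by
    intro E E' h h' N
    obtain ⟨C, hC⟩ := h N
    obtain ⟨C', hC'⟩ := h' N
    refine ⟨C + C', fun p hp => ?_⟩
    have h1 := hC p hp
    have h2 := hC' p hp
    have h0 : 0 ≤ p.2 0 ^ N := pow_nonneg (by linarith [hp.2.2 0]) _
    have h3 := mul_le_mul_of_nonneg_right (abs_add_le (E p) (E' p)) h0
    rw [Pi.add_apply]
    linarith
  zero_mem' := fun N => ⟨0, fun p _ => by simp⟩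
  smul_mem' := by
    intro c E h N
    obtain ⟨C, hC⟩ := h N
    refine ⟨|c| * C, fun p hp => ?_⟩
    have h1 := mul_le_mul_of_nonneg_left (hC p hp) (abs_nonneg c)
    simp only [Pi.smul_apply, smul_eq_mul, abs_mul]
    linarith

/-- Generators. -/
def gens (n : ℕ) (V : Submodule ℝ (Pt n → ℝ)) : Set (Pt (n + 1) → ℝ) :=
  {F | ∃ (j : ℤ) (k : ℕ) (G : Pt n → ℝ), G ∈ V ∧
    F = fun p => p.2 0 ^ j * p.1 0 ^ k * G (tl p)}

/-- The class of functions for the induction. -/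
def Cls : (n : ℕ) → Submodule ℝ (Pt n → ℝ)
  | 0 => ⊤
  | n + 1 => Submodule.span ℝ (gens n (Cls n)) ⊔ decaySub n

theorem Cls_gen {n : ℕ} (j : ℤ) (k : ℕ) {G : Pt n → ℝ} (hG : G ∈ Cls n) :
    (fun p => p.2 0 ^ j * p.1 0 ^ k * G (tl p)) ∈ Cls (n + 1) :=
  Submodule.mem_sup_left (Submodule.subset_span ⟨j, k, G, hG, rfl⟩)

theorem Cls_decay {n : ℕ} {E : Pt (n + 1) → ℝ} (hE : E ∈ decaySub n) : E ∈ Cls (n + 1) :=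
  Submodule.mem_sup_right hE

theorem zpow_le_pow_abs {y : ℝ} (hy : 1 ≤ y) (j : ℤ) : y ^ j ≤ y ^ j.natAbs := by
  rw [← zpow_natCast]
  exact zpow_le_zpow_right₀ hy (by omega)

theorem decay_mul {n : ℕ} {E : Pt (n + 1) → ℝ} (hE : E ∈ decaySub n) (M : ℕ) (A : ℝ)
    (w : Pt (n + 1) → ℝ)
    (hw : ∀ p ∈ GrowthSector (n + 1), |w p| ≤ A * p.2 0 ^ M) :
    (fun p => w p * E p) ∈ decaySub n := by
  intro N
  obtain ⟨C, hC⟩ := hE (M + N)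
  refine ⟨|A| * C, fun p hp => ?_⟩
  have h0 : 0 < p.2 0 := by linarith [hp.2.2 0]
  have h1 := hw p hp
  have h2 : A * p.2 0 ^ M ≤ |A| * p.2 0 ^ M :=
    mul_le_mul_of_nonneg_right (le_abs_self A) (by positivity)
  calc |w p * E p| * p.2 0 ^ N = |w p| * (|E p| * p.2 0 ^ N) := by rw [abs_mul]; ring
    _ ≤ (|A| * p.2 0 ^ M) * (|E p| * p.2 0 ^ N) :=
        mul_le_mul_of_nonneg_right (h1.trans h2) (by positivity)
    _ = |A| * (|E p| * p.2 0 ^ (M + N)) := by rw [pow_add]; ring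
    _ ≤ |A| * C := mul_le_mul_of_nonneg_left (hC p hp) (abs_nonneg _)

theorem Cls_congr {n : ℕ} {F F' : Pt (n + 1) → ℝ} (hF : F ∈ Cls (n + 1))
    (h : ∀ p ∈ GrowthSector (n + 1), F' p = F p) : F' ∈ Cls (n + 1) := by
  have : F' = F + (F' - F) := by ring
  rw [this]
  refine add_mem hF (Cls_decay fun N => ⟨0, fun p hp => ?_⟩)
  simp [h p hp]

theorem Cls_mul {n : ℕ} (a : ℤ) (b : ℕ) {F : Pt (n + 1) → ℝ} (hF : F ∈ Cls (n + 1)) :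
    (fun p => p.2 0 ^ a * p.1 0 ^ b * F p) ∈ Cls (n + 1) := by
  obtain ⟨G, hG, E, hE, rfl⟩ := Submodule.mem_sup.mp hF
  clear hF
  have hsplit : (fun p : Pt (n + 1) => p.2 0 ^ a * p.1 0 ^ b * (G + E) p) =
      (fun p => p.2 0 ^ a * p.1 0 ^ b * G p) + (fun p => p.2 0 ^ a * p.1 0 ^ b * E p) := by
    ext p; simp only [Pi.add_apply]; ring
  rw [hsplit]
  refine add_mem ?_ (Cls_decay ?_)
  · induction hG using Submodule.span_induction with
    | mem x hx =>
      obtain ⟨j, k, G, hG, rfl⟩ := hx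
      refine Cls_congr (Cls_gen (a + j) (b + k) hG) fun p hp => ?_
      have hy := hp.2.2 0
      rw [zpow_add₀ (by linarith), pow_add]
      ring
    | zero =>
      convert Submodule.zero_mem _ using 1
      ext p; simp
    | add x y _ _ hx hy =>
      have := add_mem (hx (by ext p; simp only [Pi.add_apply]; ring))
        (hy (by ext p; simp only [Pi.add_apply]; ring))
      convert this using 1
      ext p; simp only [Pi.add_apply]; ring
    | smul c x _ hx =>
      have := Submodule.smul_mem _ c (hx (by ext p; simp only [Pi.add_apply]; ring))
      convert this using 1
      ext p; simp only [Pi.smul_apply, smul_eq_mul]; ring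
  · refine decay_mul hE a.natAbs 1 _ fun p hp => ?_
    have hy := hp.2.2 0
    have hx := hp.1 0
    rw [abs_of_nonneg (mul_nonneg (zpow_nonneg (by linarith) _) (pow_nonneg hx.1.le _))]
    have h1 := zpow_le_pow_abs hy.le a
    have h2 : p.1 0 ^ b ≤ 1 := pow_le_one₀ hx.1.le hx.2.le
    have h3 : 0 ≤ p.1 0 ^ b := pow_nonneg hx.1.le _
    have h4 : 0 ≤ p.2 0 ^ a.natAbs := pow_nonneg (by linarith) _
    nlinarith

theorem Cls_mul_lin {n : ℕ} (lam bet : ℝ) (j : ℤ) (k : ℕ) {F : Pt (n + 1) → ℝ}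
    (hF : F ∈ Cls (n + 1)) :
    (fun p => (lam * p.2 0) ^ j * (lam * p.1 0 + bet) ^ k * F p) ∈ Cls (n + 1) := by
  induction k with
  | zero =>
    have := Submodule.smul_mem _ (lam ^ j) (Cls_mul j 0 hF)
    convert this using 1
    ext p; simp only [Pi.smul_apply, smul_eq_mul, mul_zpow]; ring
  | succ k ih =>
    have := add_mem (Submodule.smul_mem _ lam (Cls_mul 0 1 ih)) (Submodule.smul_mem _ bet ih)
    convert this using 1
    ext p; simp only [Pi.add_apply, Pi.smul_apply, smul_eq_mul, zpow_zero]; ring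

theorem Cls_extract {n : ℕ} {F : Pt (n + 1) → ℝ} (hF : F ∈ Cls (n + 1)) :
    ∃ (N : ℕ) (j : Fin N → ℤ) (k : Fin N → ℕ) (G : Fin N → Pt n → ℝ) (C : ℝ),
      (∀ i, G i ∈ Cls n) ∧ ∀ p ∈ GrowthSector (n + 1),
        |F p - ∑ i, p.2 0 ^ j i * p.1 0 ^ k i * G i (tl p)| ≤ C := by
  obtain ⟨H, hH, E, hE, rfl⟩ := Submodule.mem_sup.mp hF
  obtain ⟨N, c, g, rfl⟩ := Submodule.mem_span_set'.mp hH
  choose j k G hG hg using fun i => (g i).2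
  obtain ⟨C, hC⟩ := hE 0
  refine ⟨N, j, k, fun i => c i • G i, C, fun i => Submodule.smul_mem _ _ (hG i), fun p hp => ?_⟩
  have h1 := hC p hp
  have h2 : (∑ i, c i • (g i : Pt (n + 1) → ℝ)) p
      = ∑ i, p.2 0 ^ j i * p.1 0 ^ k i * (c i • G i) (tl p) := by
    rw [Finset.sum_apply]
    refine Finset.sum_congr rfl fun i _ => ?_
    rw [Pi.smul_apply, hg i]
    simp only [Pi.smul_apply, smul_eq_mul]; ring
  rw [Pi.add_apply, h2, add_sub_cancel_left]
  simpa using h1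

theorem uv_norm {n : ℕ} {p : Pt n} (k : Fin n) :
    ‖uv n p k‖ ≤ Real.exp (-(2 * Real.pi * p.2 k)) := by
  rw [Prod.norm_def, max_le_iff]
  have h := Real.exp_pos (-(2 * Real.pi * p.2 k))
  simp only [uv, Real.norm_eq_abs, abs_mul, abs_of_pos h]
  exact ⟨mul_le_of_le_one_right h.le (Real.abs_cos_le_one _),
    mul_le_of_le_one_right h.le (Real.abs_sin_le_one _)⟩

theorem uv_mem {n : ℕ} {p : Pt n} (hp : p ∈ GrowthSector n) : uv n p ∈ ClosedPolydisk n := by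
  intro k
  have h1 : Real.exp (-(2 * Real.pi * p.2 k)) ≤ 1 := by
    rw [Real.exp_le_one_iff]
    have := hp.2.2 k
    have := Real.pi_pos
    nlinarith [mul_pos Real.pi_pos (lt_trans one_pos (hp.2.2 k))]
  have h0 := Real.exp_pos (-(2 * Real.pi * p.2 k))
  simp only [uv]
  rw [mul_pow, mul_pow, ← mul_add, Real.cos_sq_add_sin_sq, mul_one]
  exact pow_le_one₀ h0.le h1

theorem exp_decay (M : ℕ) : ∃ C : ℝ, ∀ y : ℝ, 1 < y →
    Real.exp (-(2 * Real.pi * y)) * y ^ M ≤ C := by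
  refine ⟨M.factorial, fun y hy => ?_⟩
  have h1 := Real.pow_div_factorial_le_exp y (by linarith) M
  rw [div_le_iff₀ (by positivity)] at h1
  have h2 : Real.exp (-(2 * Real.pi * y)) * Real.exp y ≤ 1 := by
    rw [← Real.exp_add, Real.exp_le_one_iff]
    nlinarith [Real.pi_gt_three]
  have h0 := Real.exp_pos (-(2 * Real.pi * y))
  calc _ ≤ Real.exp (-(2 * Real.pi * y)) * (Real.exp y * M.factorial) := by gcongr
    _ = (Real.exp (-(2 * Real.pi * y)) * Real.exp y) * M.factorial := by ring
    _ ≤ 1 * M.factorial := by gcongr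
    _ = _ := one_mul _

theorem prod_y_le {n : ℕ} (m : Fin (n + 1) → ℤ) : ∀ p ∈ GrowthSector (n + 1),
    |∏ k, p.2 k ^ m k| ≤ p.2 0 ^ (∑ k, (m k).natAbs) := by
  intro p hp
  rw [Finset.abs_prod, ← Finset.prod_pow_eq_pow_sum]
  refine Finset.prod_le_prod (fun _ _ => abs_nonneg _) fun k _ => ?_
  have h1 := hp.2.2 k
  rw [abs_of_nonneg (zpow_nonneg (by linarith) _)]
  refine (zpow_le_pow_abs h1.le _).trans ?_
  exact pow_le_pow_left₀ (by linarith) (hp.2.1 0 k (Fin.zero_le _)) _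

theorem prod_x_le {n : ℕ} (m : Fin n → ℕ) : ∀ p ∈ GrowthSector n,
    |∏ k, p.1 k ^ m k| ≤ 1 := by
  intro p hp
  rw [Finset.abs_prod]
  refine Finset.prod_le_one (fun _ _ => abs_nonneg _) fun k _ => ?_
  have h1 := hp.1 k
  rw [abs_of_nonneg (pow_nonneg h1.1.le _)]
  exact pow_le_one₀ h1.1.le h1.2.le

open NNReal in
theorem Cls_base : ∀ (n : ℕ) (ρ : (Fin n → ℝ × ℝ) → ℝ) (L : ℝ≥0)
    (_ : LipschitzOnWith L ρ (ClosedPolydisk n)) (k : Fin n → ℕ) (m : Fin n → ℤ),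
    (fun p : Pt n => ρ (uv n p) * (∏ i, p.1 i ^ k i) * (∏ i, p.2 i ^ m i)) ∈ Cls n := by
  intro n
  induction n with
  | zero => intros; trivial
  | succ n ih =>
    intro ρ L hL k m
    set ρ' : (Fin n → ℝ × ℝ) → ℝ := fun q => ρ (Fin.cons 0 q) with hρ'
    have hmem : ∀ q ∈ ClosedPolydisk n, (Fin.cons 0 q : Fin (n + 1) → ℝ × ℝ)
        ∈ ClosedPolydisk (n + 1) := by
      intro q hq i
      refine Fin.cases ?_ (fun i => ?_) i
      · simp
      · simpa using hq i
    have hL' : LipschitzOnWith L ρ' (ClosedPolydisk n) := by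
      refine LipschitzOnWith.of_dist_le_mul fun q hq q' hq' => ?_
      refine (hL.dist_le_mul _ (hmem q hq) _ (hmem q' hq')).trans ?_
      refine mul_le_mul_of_nonneg_left ?_ L.2
      rw [dist_pi_le_iff dist_nonneg]
      intro i
      refine Fin.cases ?_ (fun i => ?_) i
      · simp
      · simpa using dist_le_pi_dist q q' i
    have hG := Cls_gen (m 0) (k 0) (ih ρ' L hL' (fun i => k i.succ) (fun i => m i.succ))
    have hE : (fun p : Pt (n + 1) => ρ (uv (n + 1) p) - ρ' (uv n (tl p))) ∈ decaySub n := by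
      intro N
      obtain ⟨C, hC⟩ := exp_decay N
      refine ⟨L * C, fun p hp => ?_⟩
      have h1 := hL.dist_le_mul _ (uv_mem hp) _ (hmem _ (uv_mem (tl_mem hp)))
      have h2 : dist (uv (n + 1) p) (Fin.cons 0 (uv n (tl p)))
          ≤ Real.exp (-(2 * Real.pi * p.2 0)) := by
        rw [dist_pi_le_iff (Real.exp_pos _).le]
        intro i
        refine Fin.cases ?_ (fun i => ?_) i
        · simpa using uv_norm (p := p) 0
        · have : uv (n + 1) p i.succ = uv n (tl p) i := rfl
          simp [this, (Real.exp_pos _).le]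
      rw [Real.dist_eq] at h1
      have h3 : 0 ≤ p.2 0 ^ N := pow_nonneg (by linarith [hp.2.2 0]) _
      calc _ ≤ (L * Real.exp (-(2 * Real.pi * p.2 0))) * p.2 0 ^ N :=
            mul_le_mul_of_nonneg_right (h1.trans (mul_le_mul_of_nonneg_left h2 L.2)) h3
        _ = L * (Real.exp (-(2 * Real.pi * p.2 0)) * p.2 0 ^ N) := by ring
        _ ≤ _ := mul_le_mul_of_nonneg_left (hC _ (hp.2.2 0)) L.2
    have hE' := decay_mul hE (∑ i, (m i).natAbs) 1
      (fun p => (∏ i, p.1 i ^ k i) * (∏ i, p.2 i ^ m i)) (fun p hp => by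
        rw [abs_mul]
        exact mul_le_mul (prod_x_le k p hp) (prod_y_le m p hp) (abs_nonneg _) zero_le_one)
    convert add_mem hG (Cls_decay hE') using 1
    ext p
    simp only [Pi.add_apply, Fin.prod_univ_succ]
    simp only [tl]
    ring

open NNReal in
theorem restr_lipschitz {n : ℕ} {ρ : (Fin n → ℝ × ℝ) → ℝ} (h : RestrictedAnalytic n ρ) :
    ∃ L : ℝ≥0, LipschitzOnWith L ρ (ClosedPolydisk n) := by
  obtain ⟨U, hU, hKU, hρ⟩ := h
  have hcomp : IsCompact (ClosedPolydisk n) := by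
    refine Metric.isCompact_of_isClosed_isBounded ?_ ?_
    · have : ClosedPolydisk n = ⋂ k, {q | (q k).1 ^ 2 + (q k).2 ^ 2 ≤ 1} := by
        ext q; simp [ClosedPolydisk]
      rw [this]
      exact isClosed_iInter fun k => isClosed_le (by fun_prop) continuous_const
    · refine (Metric.isBounded_closedBall (x := (0 : Fin n → ℝ × ℝ)) (r := 1)).subset ?_
      intro q hq
      rw [mem_closedBall_zero_iff, pi_norm_le_iff_of_nonneg zero_le_one]
      intro k
      rw [Prod.norm_def, max_le_iff, Real.norm_eq_abs, Real.norm_eq_abs]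
      have := hq k
      exact ⟨abs_le_one_iff_mul_self_le_one.mpr (by nlinarith [sq_nonneg (q k).2]),
        abs_le_one_iff_mul_self_le_one.mpr (by nlinarith [sq_nonneg (q k).1])⟩
  apply LocallyLipschitzOn.exists_lipschitzOnWith_of_compact hcomp
  intro q hq
  have hc : ContDiffAt ℝ 1 ρ q := (hρ q (hKU hq)).contDiffAt
  obtain ⟨K, t, ht, hl⟩ := hc.exists_lipschitzOnWith
  exact ⟨K, t, mem_nhdsWithin_of_mem_nhds ht, hl⟩

theorem mem_test_iff {n n₀ : ℕ} {α : Fin n → ℚ} {β : Fin n → ℝ} {ζ : Fin n → ℂ} {p : Pt n} :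
    p ∈ LinearTestSet n n₀ α β ζ ↔
      (∀ k l : Fin n, (k : ℕ) < n₀ → (l : ℕ) < n₀ →
        (α k : ℝ) * p.1 k + β k = α l * p.1 l + β l ∧ (α k : ℝ) * p.2 k = α l * p.2 l) ∧
      ∀ k : Fin n, n₀ ≤ (k : ℕ) → p.1 k = (ζ k).re ∧ p.2 k = (ζ k).im := by
  simp [LinearTestSet, Complex.ext_iff]

theorem main_ind : ∀ (n : ℕ) (F : Pt (n + 1) → ℝ) (_ : F ∈ Cls (n + 1)) (a b : ℝ)
    (_ : 0 ≤ a) (_ : b ≤ 1)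
    (_ : ∀ n₀ : ℕ, 1 ≤ n₀ → n₀ ≤ n + 1 →
      ∀ (α : Fin (n + 1) → ℚ) (β : Fin (n + 1) → ℝ) (ζ : Fin (n + 1) → ℂ),
        (∀ k, 0 < α k) → (∀ k, 0 < (ζ k).im) →
        ∃ C : ℝ, ∀ p ∈ GrowthSector (n + 1), p ∈ LinearTestSet (n + 1) n₀ α β ζ →
          a < p.1 0 → p.1 0 < b → |F p| ≤ C),
    ∃ C : ℝ, ∀ p ∈ GrowthSector (n + 1), a < p.1 0 → p.1 0 < b → |F p| ≤ C := by
  intro n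
  induction n with
  | zero =>
    intro F _ a b _ _ h
    obtain ⟨C, hC⟩ := h 1 le_rfl le_rfl (fun _ => 1) (fun _ => 0) (fun _ => Complex.I)
      (by simp) (by simp)
    refine ⟨C, fun p hp => hC p hp ?_⟩
    rw [mem_test_iff]
    refine ⟨fun k l _ _ => ?_, fun k hk => ?_⟩
    · have : k = l := Fin.ext (by omega)
      subst this; simp
    · omega
  | succ n ih =>
    intro F hF a b ha hb htest
    by_cases hab : a < b
    swap
    · exact ⟨0, fun p _ h1 h2 => absurd (h1.trans h2) hab⟩
    obtain ⟨N, j, k, G, CE, hG, hE⟩ := Cls_extract hF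
    -- the Laurent interpolation nodes
    obtain ⟨s, CA, hs, hCA, hA⟩ := laurent_bound (Finset.univ.image j)
    -- grouping
    have hgroup : ∀ (y : ℝ) (c : Fin N → ℝ), ∑ i, y ^ j i * c i =
        ∑ jj ∈ Finset.univ.image j, y ^ jj * ∑ i with j i = jj, c i := by
      intro y c
      rw [← Finset.sum_fiberwise_of_maps_to (g := j) (t := Finset.univ.image j)
        (fun i _ => Finset.mem_image_of_mem _ (Finset.mem_univ i))]
      refine Finset.sum_congr rfl fun jj _ => ?_
      rw [Finset.mul_sum]
      refine Finset.sum_congr rfl fun i hi => ?_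
      rw [(Finset.mem_filter.mp hi).2]
    -- step 1 : positive powers vanish
    have hpos : ∀ p ∈ GrowthSector (n + 2), a < p.1 0 → p.1 0 < b → ∀ jj ∈ Finset.univ.image j,
        0 < jj → ∑ i with j i = jj, p.1 0 ^ k i * G i (tl p) = 0 := by
      intro p hp hpa hpb jj hjj hjj0
      obtain ⟨C, hC⟩ := htest 1 le_rfl (by omega) (fun _ => 1) (fun _ => 0)
        (fun i => ⟨p.1 i, p.2 i⟩) (by simp) (fun i => by linarith [hp.2.2 i])
      have hbd : ∀ Y, p.2 0 ≤ Y →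
          |∑ i, Y ^ j i * (p.1 0 ^ k i * G i (tl p))| ≤ C + CE := by
        intro Y hY
        have hq : cn (p.1 0) Y (tl p) ∈ GrowthSector (n + 2) :=
          cn_mem (tl_mem hp) (hp.1 0).1 (hp.1 0).2 ((hp.2.2 0).trans_le hY)
            (fun i => (hp.2.1 0 i.succ (Fin.zero_le _)).trans hY)
        have h1 := hC _ hq (by
          rw [mem_test_iff]
          refine ⟨fun k l hk hl => ?_, fun k hk => ?_⟩
          · have : k = l := Fin.ext (by omega)
            subst this; simp
          · obtain ⟨i, rfl⟩ := Fin.exists_succ_eq.mpr (show k ≠ 0 by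
              rintro rfl; simp at hk)
            exact ⟨rfl, rfl⟩) hpa hpb
        have h2 := hE _ hq
        have h3 : ∑ i, (cn (p.1 0) Y (tl p)).2 0 ^ j i * (cn (p.1 0) Y (tl p)).1 0 ^ k i
            * G i (tl (cn (p.1 0) Y (tl p))) = ∑ i, Y ^ j i * (p.1 0 ^ k i * G i (tl p)) := by
          refine Finset.sum_congr rfl fun i _ => ?_
          rw [← mul_assoc]; rfl
        rw [h3] at h2
        rw [abs_le] at *
        constructor <;> linarith
      set D : ℤ → ℝ := fun jj => ∑ i with j i = jj, p.1 0 ^ k i * G i (tl p) with hD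
      have hYD : ∀ Y, p.2 0 ≤ Y → |Y ^ jj * D jj| ≤ CA * (C + CE) := by
        intro Y hY
        refine hA (fun jj => Y ^ jj * D jj) (C + CE) (fun q hq => ?_) jj hjj
        have hq1 : (1 : ℝ) ≤ q := by exact_mod_cast (hs q hq).1
        have hy := hp.2.2 0
        have := hbd (q * Y) (by nlinarith)
        rw [hgroup] at this
        convert this using 2
        refine Finset.sum_congr rfl fun jj _ => ?_
        rw [mul_zpow, mul_assoc]
      by_contra hne
      have hDpos : 0 < |D jj| := abs_pos.mpr hne
      set Y := max (p.2 0) (CA * (C + CE) / |D jj| + 1) with hYdef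
      have hY1 : 1 < Y := (hp.2.2 0).trans_le (le_max_left _ _)
      have h1 := hYD Y (le_max_left _ _)
      rw [abs_mul, abs_of_pos (zpow_pos (by linarith) _), ← le_div_iff₀ hDpos] at h1
      have h2 : CA * (C + CE) / |D jj| + 1 ≤ Y := le_max_right _ _
      have h3 : Y ^ (1 : ℤ) ≤ Y ^ jj := zpow_le_zpow_right₀ hY1.le (by omega)
      rw [zpow_one] at h3
      linarith
    -- step 2 : local boundedness in x1
    set δ : ℝ := (b - a) / 4 with hδ
    have hδ0 : 0 < δ := by rw [hδ]; linarith
    have hloc : ∀ c ∈ Set.Icc (0 : ℝ) 1, ∃ C : ℝ, ∀ p ∈ GrowthSector (n + 2),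
        a < p.1 0 → p.1 0 < b → c - δ / 2 < p.1 1 → p.1 1 < c + δ / 2 → |F p| ≤ C := by
      intro c hc
      obtain ⟨K, hK⟩ : ∃ K : ℕ, ∀ i, k i < K :=
        ⟨∑ i, k i + 1, fun i => Nat.lt_succ_of_le
          (Finset.single_le_sum (f := k) (fun _ _ => Nat.zero_le _) (Finset.mem_univ i))⟩
      choose t CB ht hCB hB using fun q : ℚ => poly_bound
        (Set.Ioo (a + δ - q * c) (b - δ - q * c)) (Set.Ioo_infinite (by rw [hδ]; linarith)) (K + 1) 3
      -- use of the induction hypothesis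
      have hFlb : ∀ q ∈ s, ∀ bet ∈ t q, ∃ C : ℝ, ∀ p ∈ GrowthSector (n + 1),
          max 0 (c - δ / 2) < p.1 0 → p.1 0 < min 1 (c + δ / 2) →
          |∑ i, ((q : ℝ) * p.2 0) ^ j i * ((q : ℝ) * p.1 0 + bet) ^ k i * G i p| ≤ C := by
        intro q hq bet hbet
        have hq1 : (1 : ℝ) ≤ q := by exact_mod_cast (hs q hq).1
        have hq2 : (q : ℝ) ≤ 2 := by exact_mod_cast (hs q hq).2
        have hq0 : 0 < q := lt_of_lt_of_le one_pos (hs q hq).1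
        have hbet' := ht q hbet
        refine ih (fun p => ∑ i, ((q : ℝ) * p.2 0) ^ j i * ((q : ℝ) * p.1 0 + bet) ^ k i * G i p)
          ?_ _ _ (le_max_left _ _) (min_le_left _ _) ?_
        · have h1 := Submodule.sum_mem (Cls (n + 1)) (t := Finset.univ)
            (fun i _ => Cls_mul_lin (q : ℝ) bet (j i) (k i) (hG i))
          convert h1 using 1
          ext p; simp [Finset.sum_apply]
        · intro n₀ hn1 hn2 α β ζ hα hζ
          obtain ⟨C, hC⟩ := htest (n₀ + 1) (by omega) (by omega)
            (Fin.cons (α 0 / q) α) (Fin.cons (β 0 - α 0 / q * bet) β) (Fin.cons Complex.I ζ)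
            (fun i => by
              refine Fin.cases ?_ (fun i => ?_) i
              · simpa using div_pos (hα 0) hq0
              · simpa using hα i)
            (fun i => by
              refine Fin.cases ?_ (fun i => ?_) i
              · simp
              · simpa using hζ i)
          refine ⟨C + CE, fun p hp hpt h1 h2 => ?_⟩
          rw [max_lt_iff] at h1
          rw [lt_min_iff] at h2
          have hx1 : a < q * p.1 0 + bet := by nlinarith [hbet'.1]
          have hx2 : q * p.1 0 + bet < b := by nlinarith [hbet'.2]
          have hy := hp.2.2 0
          have hq' : cn (q * p.1 0 + bet) (q * p.2 0) p ∈ GrowthSector (n + 2) :=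
            cn_mem hp (by linarith) (by linarith) (by nlinarith)
              (fun i => (hp.2.1 0 i (Fin.zero_le _)).trans (by nlinarith))
          rw [mem_test_iff] at hpt
          have hq0' : (q : ℝ) ≠ 0 := by linarith
          have hkey : ∀ i : Fin (n + 2), (i : ℕ) < n₀ + 1 →
              (((Fin.cons (α 0 / q) α : Fin (n + 2) → ℚ) i : ℚ) : ℝ)
                * (cn (q * p.1 0 + bet) (q * p.2 0) p).1 i
                + (Fin.cons (β 0 - α 0 / q * bet) β : Fin (n + 2) → ℝ) i
                = α 0 * p.1 0 + β 0 ∧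
              (((Fin.cons (α 0 / q) α : Fin (n + 2) → ℚ) i : ℚ) : ℝ)
                * (cn (q * p.1 0 + bet) (q * p.2 0) p).2 i = α 0 * p.2 0 := by
            intro i
            refine Fin.cases ?_ (fun i => ?_) i
            · intro _
              simp only [cn, Fin.cons_zero]
              push_cast
              constructor <;> field_simp
              ring
            · intro hi
              simp only [cn, Fin.cons_succ]
              exact hpt.1 i 0 (by simpa using hi) (by simpa using Nat.lt_of_succ_le hn1)
          have h3 := hC _ hq' (by
            rw [mem_test_iff]
            refine ⟨fun k l hk hl => ⟨?_, ?_⟩, fun k => ?_⟩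
            · rw [(hkey k hk).1, (hkey l hl).1]
            · rw [(hkey k hk).2, (hkey l hl).2]
            · refine Fin.cases ?_ (fun i => ?_) k
              · intro h; simp at h
              · intro h
                exact hpt.2 i (by simpa using h)) hx1 hx2
          have h4 := hE _ hq'
          have h5 : ∑ i, (cn (q * p.1 0 + bet) (q * p.2 0) p).2 0 ^ j i
              * (cn (q * p.1 0 + bet) (q * p.2 0) p).1 0 ^ k i
              * G i (tl (cn (q * p.1 0 + bet) (q * p.2 0) p))
              = ∑ i, ((q : ℝ) * p.2 0) ^ j i * ((q : ℝ) * p.1 0 + bet) ^ k i * G i p := rfl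
          rw [h5] at h4
          rw [abs_le] at *
          constructor <;> linarith
      -- uniform bound M
      choose! CM hCM using hFlb
      obtain ⟨M, hM0, hM⟩ : ∃ M : ℝ, 0 ≤ M ∧ ∀ q ∈ s, ∀ bet ∈ t q, CM q bet ≤ M := by
        refine ⟨∑ q ∈ s, ∑ bet ∈ t q, |CM q bet|, by positivity, fun q hq bet hbet => ?_⟩
        refine (le_abs_self _).trans ?_
        refine (Finset.single_le_sum (f := fun bet => |CM q bet|)
          (fun _ _ => abs_nonneg _) hbet).trans ?_
        exact Finset.single_le_sum (f := fun q => ∑ bet ∈ t q, |CM q bet|)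
          (fun _ _ => by positivity) hq
      set M' : ℝ := ∑ q ∈ s, CB q * M with hM'
      refine ⟨CE + (Finset.univ.image j).card * (CA * M'), fun p hp hpa hpb hp1 hp2 => ?_⟩
      have hp' := tl_mem hp
      have hx1 := hp.1 1
      have hy1 := hp.2.2 1
      have hy0 := hp.2.1 0 1 (Fin.zero_le _)
      set H : Fin N → ℝ := fun i => p.2 1 ^ j i * G i (tl p) with hH
      have hP : ∀ q ∈ s, |∑ i, (q : ℝ) ^ j i * (p.1 0 ^ k i * H i)| ≤ M' := by
        intro q hq
        have hq1 : (1 : ℝ) ≤ q := by exact_mod_cast (hs q hq).1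
        have hq2 : (q : ℝ) ≤ 2 := by exact_mod_cast (hs q hq).2
        set P : ℝ[X] := ∑ i, Polynomial.C ((q : ℝ) ^ j i * H i) *
          (Polynomial.X + Polynomial.C ((q : ℝ) * p.1 1)) ^ k i with hPdef
        have hev : ∀ u, P.eval u = ∑ i, (q : ℝ) ^ j i * ((q * p.1 1 + u) ^ k i * H i) := by
          intro u
          rw [hPdef, Polynomial.eval_finsetSum]
          refine Finset.sum_congr rfl fun i _ => ?_
          simp only [eval_mul, eval_C, eval_pow, eval_add, eval_X]
          ring
        have hdeg : P.natDegree < K + 1 := by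
          rw [Nat.lt_succ_iff]
          refine Polynomial.natDegree_sum_le_of_forall_le _ _ fun i _ => ?_
          refine (Polynomial.natDegree_C_mul_le _ _).trans ?_
          refine (Polynomial.natDegree_pow_le).trans ?_
          rw [Polynomial.natDegree_X_add_C, mul_one]
          exact (hK i).le
        have h1 := hB q P M hdeg (fun bet hbet => by
          have h2 := hCM q hq bet hbet (tl p) hp'
            (max_lt hx1.1 hp1) (lt_min hx1.2 hp2)
          refine le_trans (le_of_eq ?_) (h2.trans (hM q hq bet hbet))
          rw [hev]
          congr 1
          refine Finset.sum_congr rfl fun i _ => ?_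
          have e1 : (tl p).2 0 = p.2 1 := rfl
          have e2 : (tl p).1 0 = p.1 1 := rfl
          rw [e1, e2, hH, mul_zpow]
          ring) (p.1 0 - q * p.1 1) (by
            have := hp.1 0
            rw [abs_le]; constructor <;> nlinarith)
        rw [hev] at h1
        have e3 : (q : ℝ) * p.1 1 + (p.1 0 - q * p.1 1) = p.1 0 := by ring
        rw [e3] at h1
        refine h1.trans ?_
        exact Finset.single_le_sum (f := fun q => CB q * M)
          (fun q _ => mul_nonneg (hCB q) hM0) hq
      have hM'0 : 0 ≤ M' := Finset.sum_nonneg fun q _ => mul_nonneg (hCB q) hM0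
      have hD := hA (fun jj => ∑ i with j i = jj, p.1 0 ^ k i * H i) M' (fun q hq => by
        rw [← hgroup]; exact hP q hq)
      have hF1 := hE p hp
      have hF2 : |∑ i, p.2 0 ^ j i * p.1 0 ^ k i * G i (tl p)|
          ≤ (Finset.univ.image j).card * (CA * M') := by
        have e4 : ∑ i, p.2 0 ^ j i * p.1 0 ^ k i * G i (tl p)
            = ∑ i, p.2 0 ^ j i * (p.1 0 ^ k i * G i (tl p)) := by
          simp only [mul_assoc]
        rw [e4, hgroup, ← nsmul_eq_mul]
        refine (Finset.abs_sum_le_sum_abs _ _).trans (Finset.sum_le_card_nsmul _ _ _ ?_)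
        intro jj hjj
        rcases lt_or_ge 0 jj with h | h
        · rw [hpos p hp hpa hpb jj hjj h]
          simpa using mul_nonneg hCA hM'0
        · have e5 : ∑ i with j i = jj, p.1 0 ^ k i * H i
              = p.2 1 ^ jj * ∑ i with j i = jj, p.1 0 ^ k i * G i (tl p) := by
            rw [Finset.mul_sum]
            refine Finset.sum_congr rfl fun i hi => ?_
            rw [hH, (Finset.mem_filter.mp hi).2.symm]
            ring
          have h6 := hD jj hjj
          rw [e5, abs_mul] at h6
          rw [abs_mul]
          refine le_trans (mul_le_mul_of_nonneg_right ?_ (abs_nonneg _)) h6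
          rw [abs_of_pos (zpow_pos (by linarith) _), abs_of_pos (zpow_pos (by linarith) _)]
          obtain ⟨m, rfl⟩ : ∃ m : ℕ, jj = -(m : ℤ) := ⟨jj.natAbs, by omega⟩
          rw [zpow_neg, zpow_neg, zpow_natCast, zpow_natCast]
          exact inv_anti₀ (pow_pos (by linarith) _) (pow_le_pow_left₀ (by linarith) hy0 _)
      rw [abs_le] at *
      constructor <;> linarith
    -- compactness
    have hcpt : ∃ C : ℝ, ∀ p ∈ GrowthSector (n + 2), a < p.1 0 → p.1 0 < b →
        p.1 1 ∈ Set.Icc (0 : ℝ) 1 → |F p| ≤ C := by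
      refine IsCompact.induction_on (p := fun S => ∃ C : ℝ, ∀ p ∈ GrowthSector (n + 2),
        a < p.1 0 → p.1 0 < b → p.1 1 ∈ S → |F p| ≤ C) isCompact_Icc ?_ ?_ ?_ ?_
      · exact ⟨0, fun p _ _ _ h => absurd h (Set.notMem_empty _)⟩
      · rintro S S' hSS ⟨C, hC⟩
        exact ⟨C, fun p hp h1 h2 h3 => hC p hp h1 h2 (hSS h3)⟩
      · rintro S S' ⟨C, hC⟩ ⟨C', hC'⟩
        refine ⟨max C C', fun p hp h1 h2 h3 => ?_⟩
        rcases h3 with h3 | h3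
        · exact (hC p hp h1 h2 h3).trans (le_max_left _ _)
        · exact (hC' p hp h1 h2 h3).trans (le_max_right _ _)
      · intro c hc
        obtain ⟨C, hC⟩ := hloc c hc
        refine ⟨Set.Ioo (c - δ / 2) (c + δ / 2),
          mem_nhdsWithin_of_mem_nhds (Ioo_mem_nhds (by linarith) (by linarith)),
          C, fun p hp h1 h2 h3 => hC p hp h1 h2 h3.1 h3.2⟩
    obtain ⟨C, hC⟩ := hcpt
    exact ⟨C, fun p hp h1 h2 => hC p hp h1 h2 ⟨(hp.1 1).1.le, (hp.1 1).2.le⟩⟩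

theorem sim_abs {n : ℕ} {f : Pt n → ℝ} (h : MonGrowth n f) : ∃ (m : Fin n → ℤ) (c C : ℝ),
    0 < c ∧ 0 < C ∧ ∀ p ∈ GrowthSector n, 0 < monomial n m p ∧
      c * monomial n m p ≤ |f p| ∧ |f p| ≤ C * monomial n m p := by
  obtain ⟨m, C₁, C₂, hC, h⟩ := h
  have hmon : ∀ p ∈ GrowthSector n, 0 < monomial n m p := fun p hp =>
    Finset.prod_pos fun k _ => zpow_pos (by linarith [hp.2.2 k]) _
  rcases pos_and_pos_or_neg_and_neg_of_mul_pos hC with ⟨h1, h2⟩ | ⟨h1, h2⟩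
  · refine ⟨m, C₁, C₂, h1, h2, fun p hp => ⟨hmon p hp, ?_⟩⟩
    have h3 := h p hp
    have := mul_pos h1 (hmon p hp)
    rw [abs_of_pos (by linarith)]
    exact ⟨h3.1.le, h3.2.le⟩
  · refine ⟨m, -C₂, -C₁, by linarith, by linarith, fun p hp => ⟨hmon p hp, ?_⟩⟩
    have h3 := h p hp
    have := mul_pos (neg_pos.mpr h2) (hmon p hp)
    rw [abs_of_neg (by linarith)]
    constructor <;> linarith

end Helpers

/-- Curve-reduction lemma. If `f` is polynomially tamed, `g` is
monomially tamed, and `|f| ≺ |g|` on every linear test set (for all `1 ≤ n₀ ≤ n`,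
positive rationals `αᵏ`, reals `βᵏ`, and `ζᵏ` with positive imaginary part), then
`|f| ≺ |g|` on all of `Σ_n`. -/
theorem statement0 (n : ℕ) (hn : 1 ≤ n) (f g : Pt n → ℝ)
    (hf : PolyTamed n f) (hg : MonTamed n g)
    (hyp : ∀ n₀ : ℕ, 1 ≤ n₀ → n₀ ≤ n →
      ∀ (α : Fin n → ℚ) (β : Fin n → ℝ) (ζ : Fin n → ℂ),
        (∀ k, 0 < α k) → (∀ k, 0 < (ζ k).im) →
        Prec (GrowthSector n ∩ LinearTestSet n n₀ α β ζ)
          (fun p => |f p|) (fun p => |g p|)) :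
    Prec (GrowthSector n) (fun p => |f p|) (fun p => |g p|) := by
  obtain ⟨n, rfl⟩ : ∃ n', n = n' + 1 := ⟨n - 1, by omega⟩
  obtain ⟨G, h, hG, hh, hh0, hfG⟩ := hf
  obtain ⟨T, ρ, hρ, hGsum⟩ := hG
  obtain ⟨mh, ch, Ch, hch, hCh, hhb⟩ := sim_abs hh.2
  obtain ⟨mg, cg, Cg, hcg, hCg, hgb⟩ := sim_abs hg.2
  set F : Pt (n + 1) → ℝ := fun p =>
    G p / (monomial (n + 1) mh p * monomial (n + 1) mg p) with hFdef
  have hmem : F ∈ Cls (n + 1) := by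
    have h1 : ∀ km ∈ T, (fun p : Pt (n + 1) => ρ km p * (∏ k, p.1 k ^ km.1 k) *
        (∏ k, p.2 k ^ (km.2 k - mh k - mg k))) ∈ Cls (n + 1) := by
      intro km hkm
      obtain ⟨r, hr, hrr⟩ := hρ km hkm
      obtain ⟨L, hL⟩ := restr_lipschitz hr
      refine Cls_congr (Cls_base (n + 1) r L hL km.1 (fun k => km.2 k - mh k - mg k))
        fun p hp => ?_
      rw [hrr p hp]
    refine Cls_congr (Submodule.sum_mem _ h1) fun p hp => ?_
    rw [hFdef]
    simp only [Finset.sum_apply]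
    rw [hGsum p hp, Finset.sum_div]
    refine Finset.sum_congr rfl fun km _ => ?_
    rw [mul_div_assoc, monomial, monomial, ← Finset.prod_mul_distrib, ← Finset.prod_div_distrib]
    congr 1
    refine Finset.prod_congr rfl fun k _ => ?_
    have hy : p.2 k ≠ 0 := by linarith [hp.2.2 k]
    rw [zpow_sub₀ hy, zpow_sub₀ hy, div_div]
  obtain ⟨C, hC⟩ := main_ind n F hmem 0 1 le_rfl le_rfl (by
    intro n₀ h1 h2 α β ζ hα hζ
    obtain ⟨C, hC0, hC⟩ := hyp n₀ h1 h2 α β ζ hα hζ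
    refine ⟨C * (Cg * Ch), fun p hp hpt _ _ => ?_⟩
    have h3 := hC p ⟨hp, hpt⟩
    obtain ⟨a1, a2, a3⟩ := hhb p hp
    obtain ⟨b1, b2, b3⟩ := hgb p hp
    have hhp : 0 < |h p| := abs_pos.mpr (hh0 p hp)
    simp only [hfG p hp, abs_div] at h3
    rw [div_lt_iff₀ hhp] at h3
    rw [hFdef]
    simp only [abs_div]
    rw [abs_of_pos (mul_pos a1 b1), div_le_iff₀ (mul_pos a1 b1)]
    refine h3.le.trans ?_
    calc C * |g p| * |h p| ≤ C * (Cg * monomial (n + 1) mg p) * (Ch * monomial (n + 1) mh p) := by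
          gcongr
      _ = _ := by ring)
  refine ⟨|C| / (cg * ch) + 1, by positivity, fun p hp => ?_⟩
  have h3 := (hC p hp (hp.1 0).1 (hp.1 0).2).trans (le_abs_self C)
  obtain ⟨a1, a2, a3⟩ := hhb p hp
  obtain ⟨b1, b2, b3⟩ := hgb p hp
  have hhp : 0 < |h p| := abs_pos.mpr (hh0 p hp)
  have hgp : 0 < |g p| := lt_of_lt_of_le (mul_pos hcg b1) b2
  rw [hFdef] at h3
  simp only [abs_div] at h3
  rw [abs_of_pos (mul_pos a1 b1), div_le_iff₀ (mul_pos a1 b1)] at h3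
  simp only [hfG p hp, abs_div]
  rw [div_lt_iff₀ hhp]
  have h4 : |C| * (monomial (n + 1) mh p * monomial (n + 1) mg p)
      ≤ |C| / (cg * ch) * (|g p| * |h p|) := by
    rw [div_mul_eq_mul_div, le_div_iff₀ (mul_pos hcg hch), mul_assoc]
    refine mul_le_mul_of_nonneg_left ?_ (abs_nonneg C)
    calc _ = (cg * monomial (n + 1) mg p) * (ch * monomial (n + 1) mh p) := by ring
      _ ≤ _ := by gcongr
  have h5 := mul_pos hgp hhp
  nlinarith

end

end TamePaper
end

section
/- Let f, g ∈ O(x,y) with f polynomially tamed and g monomially tamed on Σ_n. For 1 ≤ n̂ ≤ n let C_e^{(n̂)} be the set of integer vectors e ∈ ℕ^n with e^1 ≥ e^2 ≥ ⋯ ≥ e^{n̂} > 0 and e^{n̂+1} = ⋯ = e^n = 0, and let P_e^{(n̂)} be the collection of subsets of Σ_n of the form Σ_n ∩ {(x,y) : φ^α = φ_0^α + e^α ρ for some ρ ∈ ℂ with Im ρ ≥ 0}, where e ∈ C_e^{(n̂)}, φ^α = x^α + i y^α, and the base point φ_0^α = a_0^α + i s_0^α satisfies s_0^1 > s_0^2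 > ⋯ > s_0^n > 1 and 0 < a_0^α < 1. If |f| ≺ |g| holds on every set in P_e^{(n̂)} for every n̂ ∈ {1, …, n}, then |f| ≺ |g| holds on all of Σ_n. -/
namespace TamePaper

noncomputable section

/-- The image in field space of the backreaction of a BPS string of charge `e`,
based at `φ₀ = a₀ + i s₀`: the set of points with `φᵏ = φ₀ᵏ + eᵏ ρ` for some
`ρ ∈ ℂ` with `Im ρ ≥ 0`, where `φᵏ = xᵏ + i yᵏ`. -/
def StringPathSet (n : ℕ) (e : Fin n → ℕ) (a₀ s₀ : Fin n → ℝ) : Set (Pt n) :=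
  {p | ∃ ρ : ℂ, 0 ≤ ρ.im ∧ ∀ k : Fin n,
      (p.1 k : ℂ) + (p.2 k : ℂ) * Complex.I
        = ((a₀ k : ℂ) + (s₀ k : ℂ) * Complex.I) + (e k : ℂ) * ρ}


lemma polydisk_convex (n : ℕ) : Convex ℝ (ClosedPolydisk n) := by
  intro p hp q hq a b ha hb hab k
  have h1 := hp k
  have h2 := hq k
  simp only [Pi.add_apply, Pi.smul_apply, Prod.fst_add, Prod.snd_add, Prod.smul_fst,
    Prod.smul_snd, smul_eq_mul]
  obtain rfl : b = 1 - a := by linarith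
  nlinarith [mul_nonneg (mul_nonneg ha hb) (add_nonneg (sq_nonneg ((p k).1 - (q k).1))
    (sq_nonneg ((p k).2 - (q k).2))), mul_le_mul_of_nonneg_left h1 ha,
    mul_le_mul_of_nonneg_left h2 hb]

lemma polydisk_compact (n : ℕ) : IsCompact (ClosedPolydisk n) := by
  apply Metric.isCompact_of_isClosed_isBounded
  · have : ClosedPolydisk n = ⋂ k : Fin n, {q | (q k).1 ^ 2 + (q k).2 ^ 2 ≤ 1} := by
      ext q; simp [ClosedPolydisk]
    rw [this]
    refine isClosed_iInter fun k => isClosed_le ?_ continuous_const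
    fun_prop
  · refine (Metric.isBounded_closedBall (x := (0 : Fin n → ℝ × ℝ)) (r := 1)).subset ?_
    intro q hq
    rw [mem_closedBall_zero_iff, pi_norm_le_iff_of_nonneg zero_le_one]
    intro k
    have := hq k
    rw [Prod.norm_def]
    refine max_le ?_ ?_ <;> rw [Real.norm_eq_abs] <;> apply abs_le_one_iff_mul_self_le_one.2
    · nlinarith [sq_nonneg (q k).2]
    · nlinarith [sq_nonneg (q k).1]

lemma restricted_lip {n : ℕ} {ρ : (Fin n → ℝ × ℝ) → ℝ} (h : RestrictedAnalytic n ρ) :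
    ∃ K, LipschitzOnWith K ρ (ClosedPolydisk n) := by
  obtain ⟨U, hU, hs, ha⟩ := h
  have : ContDiffOn ℝ 1 ρ (ClosedPolydisk n) := (ha.contDiffOn hU.uniqueDiffOn).mono hs
  exact this.exists_lipschitzOnWith one_ne_zero (polydisk_convex n) (polydisk_compact n)

lemma prod_zpow_same {ι : Type*} {c : ℝ} (hc : c ≠ 0) (I : Finset ι) (m : ι → ℤ) :
    ∏ i ∈ I, c ^ m i = c ^ (∑ i ∈ I, m i) := by
  classical
  induction I using Finset.induction_on with
  | empty => simp
  | insert a s ha ih => rw [Finset.prod_insert ha, Finset.sum_insert ha, zpow_add₀ hc, ih]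

lemma key_lim {n : ℕ} {ι : Type*} (I : Finset (Fin n)) (S : Finset ι) (A : ι → ℝ)
    (m : ι → Fin n → ℤ) (y : ℕ → Fin n → ℝ) (c : ℕ → ℝ) (e : Fin n → ℝ)
    (hc : Filter.Tendsto c Filter.atTop Filter.atTop)
    (he : ∀ k ∈ I, 0 < e k)
    (hy : ∀ k ∈ I, Filter.Tendsto (fun N => y N k / c N) Filter.atTop (nhds (e k)))
    (D : ℤ) (hS : ∀ t ∈ S, ∑ i ∈ I, m t i ≤ D) :
    Filter.Tendsto (fun N => (∑ t ∈ S, A t * ∏ i ∈ I, y N i ^ m t i) / c N ^ D) Filter.atTop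
      (nhds (∑ t ∈ S with ∑ i ∈ I, m t i = D, A t * ∏ i ∈ I, e i ^ m t i)) := by
  rw [Finset.sum_filter]
  simp_rw [Finset.sum_div]
  refine tendsto_finsetSum _ fun t ht => ?_
  have h1 : Filter.Tendsto (fun N => ∏ i ∈ I, (y N i / c N) ^ m t i) Filter.atTop
      (nhds (∏ i ∈ I, e i ^ m t i)) :=
    tendsto_finsetProd _ fun i hi => (hy i hi).zpow₀ _ (Or.inl (he i hi).ne')
  have h2 : ∀ᶠ N in Filter.atTop, (A t * ∏ i ∈ I, (y N i / c N) ^ m t i) *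
      c N ^ (∑ i ∈ I, m t i - D) = (A t * ∏ i ∈ I, y N i ^ m t i) / c N ^ D := by
    filter_upwards [hc.eventually_gt_atTop 0] with N hN
    have : ∏ i ∈ I, c N ^ m t i = c N ^ (∑ i ∈ I, m t i) :=
      prod_zpow_same hN.ne' I (m t)
    simp_rw [div_zpow]
    rw [Finset.prod_div_distrib, this, zpow_sub₀ hN.ne']
    have := (zpow_pos hN (∑ i ∈ I, m t i)).ne'
    field_simp
  refine Filter.Tendsto.congr' h2 ?_
  split_ifs with hD
  · simpa [hD] using h1.const_mul (A t)
  · have hlt : ∑ i ∈ I, m t i - D < 0 := by have := hS t ht; omega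
    have h3 : Filter.Tendsto (fun N => c N ^ (∑ i ∈ I, m t i - D)) Filter.atTop (nhds 0) :=
      (tendsto_zpow_atTop_zero hlt).comp hc
    simpa using (h1.const_mul (A t)).mul h3

lemma key {n : ℕ} {ι : Type*} (I : Finset (Fin n)) (S : Finset ι) (A : ι → ℝ)
    (m : ι → Fin n → ℤ) (s : Fin n → ℝ) (hs : ∀ k ∈ I, 1 < s k)
    (hanti : ∀ k ∈ I, ∀ l ∈ I, k ≤ l → s l ≤ s k)
    (hb : ∀ e : Fin n → ℕ, (∀ k ∈ I, 0 < e k) → (∀ k ∈ I, ∀ l ∈ I, k ≤ l → e l ≤ e k) →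
      ∃ C, ∀ σ : ℝ, 0 ≤ σ → |∑ t ∈ S, A t * ∏ i ∈ I, (s i + e i * σ) ^ m t i| ≤ C) :
    ∑ t ∈ S with 0 < ∑ i ∈ I, m t i, A t * ∏ i ∈ I, s i ^ m t i = 0 := by
  classical
  -- homogeneous components
  set P : ℤ → (Fin n → ℝ) → ℝ := fun D y =>
    ∑ t ∈ S with ∑ i ∈ I, m t i = D, A t * ∏ i ∈ I, y i ^ m t i with hP
  set Ch : Set (Fin n → ℝ) := {y | (∀ k ∈ I, 1 ≤ y k) ∧ ∀ k ∈ I, ∀ l ∈ I, k ≤ l → y l ≤ y k}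
  -- decomposition
  have decomp : ∀ (p : ℤ → Prop) [DecidablePred p] (y : Fin n → ℝ),
      ∑ t ∈ S with p (∑ i ∈ I, m t i), A t * ∏ i ∈ I, y i ^ m t i =
      ∑ D ∈ S.image (fun t => ∑ i ∈ I, m t i) with p D, P D y := by
    intro p _ y
    rw [Finset.sum_filter, Finset.sum_filter]
    rw [← Finset.sum_fiberwise_of_maps_to (s := S) (t := S.image (fun t => ∑ i ∈ I, m t i))
      (g := fun t => ∑ i ∈ I, m t i) (fun t ht => Finset.mem_image_of_mem _ ht)]
    refine Finset.sum_congr rfl fun D _ => ?_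
    simp only [hP]
    split_ifs with h
    · refine Finset.sum_congr rfl fun t ht => ?_
      rw [Finset.mem_filter] at ht
      rw [if_pos (by rw [ht.2]; exact h)]
    · refine Finset.sum_eq_zero fun t ht => ?_
      rw [Finset.mem_filter] at ht
      rw [if_neg (by rw [ht.2]; exact h)]
  -- descending induction
  obtain ⟨B, hB⟩ : ∃ B : ℤ, ∀ t ∈ S, ∑ i ∈ I, m t i ≤ B := by
    obtain ⟨B, hB⟩ := (S.image (fun t => ∑ i ∈ I, m t i)).bddAbove
    exact ⟨B, fun t ht => hB (by simpa using ⟨t, ht, rfl⟩)⟩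
  have natz : ∀ D : ℤ, 0 < D → (∀ D' > D, ∀ y ∈ Ch, P D' y = 0) → 
      ∀ e : Fin n → ℕ, (fun i => (e i : ℝ)) ∈ Ch → P D (fun i => (e i : ℝ)) = 0 := by
    intro D hD hvan e he
    have he0 : ∀ k ∈ I, 0 < e k := fun k hk => by
      have h : (1 : ℝ) ≤ (e k : ℝ) := he.1 k hk
      have : 1 ≤ e k := by exact_mod_cast h
      omega
    obtain ⟨C, hC⟩ := hb e he0 (fun k hk l hl hkl => by
      have h : (e l : ℝ) ≤ (e k : ℝ) := he.2 k hk l hl hkl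
      exact_mod_cast h)
    have L := key_lim I (S.filter fun t => ∑ i ∈ I, m t i ≤ D) A m
      (fun N i => s i + e i * (N : ℝ)) (fun N => (N : ℝ)) (fun i => e i)
      tendsto_natCast_atTop_atTop (fun k hk => by exact_mod_cast he0 k hk)
      (fun k hk => by
        have h0 : Filter.Tendsto (fun N : ℕ => s k / (N : ℝ) + e k) Filter.atTop
          (nhds (0 + (e k : ℝ))) := (tendsto_const_div_atTop_nhds_zero_nat (s k)).add_const _
        rw [zero_add] at h0
        refine h0.congr' ?_
        filter_upwards [Filter.eventually_gt_atTop 0] with N hN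
        have : (N : ℝ) ≠ 0 := by positivity
        field_simp) D (by simp)
    rw [Finset.filter_filter] at L
    have e1 : (S.filter fun t => ∑ i ∈ I, m t i ≤ D ∧ ∑ i ∈ I, m t i = D) =
      S.filter fun t => ∑ i ∈ I, m t i = D := by
      ext t; simp only [Finset.mem_filter]; constructor
      · rintro ⟨a, b, c⟩; exact ⟨a, c⟩
      · rintro ⟨a, c⟩; exact ⟨a, c.le, c⟩
    rw [e1] at L
    refine tendsto_nhds_unique L ?_
    have hbd : ∀ N : ℕ, |∑ t ∈ S with ∑ i ∈ I, m t i ≤ D,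
        A t * ∏ i ∈ I, (s i + e i * (N : ℝ)) ^ m t i| ≤ C := by
      intro N
      have h1 := hC N (Nat.cast_nonneg N)
      rw [← Finset.sum_filter_add_sum_filter_not S (fun t => ∑ i ∈ I, m t i ≤ D)] at h1
      have h2 : ∑ t ∈ S with ¬ (∑ i ∈ I, m t i ≤ D),
        A t * ∏ i ∈ I, (s i + e i * (N : ℝ)) ^ m t i = 0 := by
        rw [decomp (fun d => ¬ d ≤ D) (fun i => s i + e i * (N : ℝ))]
        refine Finset.sum_eq_zero fun D' hD' => ?_
        rw [Finset.mem_filter] at hD'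
        refine hvan D' (by omega) _ ⟨fun k hk => ?_, fun k hk l hl hkl => ?_⟩
        · have := hs k hk
          have : (0:ℝ) ≤ e k * N := by positivity
          linarith
        · have h5 := hanti k hk l hl hkl
          have h6 := he.2 k hk l hl hkl
          have : (e l : ℝ) * N ≤ e k * N := by gcongr
          show s l + e l * (N : ℝ) ≤ s k + e k * (N : ℝ)
          linarith
      rw [h2, add_zero] at h1
      exact h1
    have hinv : Filter.Tendsto (fun N : ℕ => C * ((N : ℝ) ^ D)⁻¹) Filter.atTop (nhds 0) := by
      have := ((tendsto_zpow_atTop_zero (𝕜 := ℝ) (n := -D) (by omega)).const_mul C).comp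
        (tendsto_natCast_atTop_atTop (R := ℝ))
      rw [mul_zero] at this
      refine this.congr fun N => ?_
      simp [zpow_neg]
    refine squeeze_zero_norm (fun N => ?_) hinv
    rw [Real.norm_eq_abs, abs_div, div_eq_mul_inv, abs_of_nonneg (by positivity : (0:ℝ) ≤ (N:ℝ) ^ D)]
    exact mul_le_mul_of_nonneg_right (hbd N) (by positivity)
  have step : ∀ D : ℤ, 0 < D → (∀ D' > D, ∀ y ∈ Ch, P D' y = 0) → ∀ y ∈ Ch, P D y = 0 := by
    intro D hD hvan y hy
    have hc : Filter.Tendsto (fun N : ℕ => ((N : ℝ) + 1)) Filter.atTop Filter.atTop :=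
      Filter.tendsto_atTop_add_const_right _ _ tendsto_natCast_atTop_atTop
    have L := key_lim I (S.filter fun t => ∑ i ∈ I, m t i = D) A m
      (fun N i => ((⌊y i * ((N : ℝ) + 1)⌋₊ : ℕ) : ℝ)) (fun N => (N : ℝ) + 1) y hc
      (fun k hk => by linarith [hy.1 k hk])
      (fun k hk => (tendsto_nat_floor_mul_div_atTop (by linarith [hy.1 k hk])).comp hc) D
      (fun t ht => (Finset.mem_filter.1 ht).2.le)
    rw [Finset.filter_filter] at L
    simp only [and_self] at L
    refine tendsto_nhds_unique L ?_
    refine Filter.Tendsto.congr (fun N => ?_) tendsto_const_nhds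
    have := natz D hD hvan (fun i => ⌊y i * ((N : ℝ) + 1)⌋₊) ⟨fun k hk => ?_, fun k hk l hl hkl => ?_⟩
    · simp only [hP] at this
      rw [this, zero_div]
    · have h1 := hy.1 k hk
      have : 1 ≤ ⌊y k * ((N : ℝ) + 1)⌋₊ := by
        apply Nat.le_floor
        have : (0:ℝ) ≤ N := by positivity
        push_cast
        nlinarith
      show (1 : ℝ) ≤ ((⌊y k * ((N : ℝ) + 1)⌋₊ : ℕ) : ℝ)
      exact Nat.one_le_cast.2 this
    · have h1 := hy.2 k hk l hl hkl
      have : ⌊y l * ((N : ℝ) + 1)⌋₊ ≤ ⌊y k * ((N : ℝ) + 1)⌋₊ := by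
        apply Nat.floor_le_floor
        gcongr
      exact Nat.cast_le.2 this
  have all : ∀ j : ℕ, ∀ D : ℤ, 0 < D → B - j < D → ∀ y ∈ Ch, P D y = 0 := by
    intro j
    induction j with
    | zero =>
      intro D _ hD y _
      simp only [hP]
      rw [Finset.filter_false_of_mem, Finset.sum_empty]
      intro t ht h
      have := hB t ht
      push_cast at hD
      omega
    | succ j ih =>
      intro D h0 hD
      refine step D h0 fun D' hD' => ih D' (by omega) (by push_cast at hD; omega)
  rw [decomp (fun d => 0 < d) s]
  refine Finset.sum_eq_zero fun D hD => ?_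
  rw [Finset.mem_filter] at hD
  exact all (B - D + 1).toNat D hD.2 (by omega) s ⟨fun k hk => (hs k hk).le, hanti⟩


def pre (n j : ℕ) : Finset (Fin n) := Finset.univ.filter fun i => (i : ℕ) < j

def uvt (n j : ℕ) (p : Pt n) : Fin n → ℝ × ℝ := fun k => if (k : ℕ) < j then 0 else uv n p k

lemma mem_pre {n j : ℕ} {i : Fin n} : i ∈ pre n j ↔ (i : ℕ) < j := by simp [pre]

lemma pre_succ {n j : ℕ} (h : j < n) : pre n (j + 1) = insert ⟨j, h⟩ (pre n j) := by
  ext i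
  simp only [mem_pre, Finset.mem_insert, Fin.ext_iff]
  omega

lemma abel_bound {n : ℕ} (y : Fin n → ℝ) (m : Fin n → ℤ)
    (hanti : ∀ k l : Fin n, k ≤ l → y l ≤ y k) (h1 : ∀ k, 1 ≤ y k) (j : ℕ) (hj : j ≤ n)
    (hm : ∀ l ≤ j, ∑ i ∈ pre n l, m i ≤ 0) :
    ∀ Y0 : ℝ, 1 ≤ Y0 → (∀ i ∈ pre n j, Y0 ≤ y i) →
      ∏ i ∈ pre n j, y i ^ m i ≤ Y0 ^ (∑ i ∈ pre n j, m i) := by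
  induction j with
  | zero => intro Y0 _ _; simp [pre]
  | succ j ih =>
    intro Y0 hY hle
    have hjn : j < n := hj
    have h2 := ih hjn.le (fun l hl => hm l (by omega)) (y ⟨j, hjn⟩) (h1 _) (fun i hi =>
      hanti _ _ (by rw [mem_pre] at hi; exact Fin.le_def.2 hi.le))
    have h3 := hm (j + 1) le_rfl
    have h4 := hle ⟨j, hjn⟩ (by simp [mem_pre])
    have hnot : (⟨j, hjn⟩ : Fin n) ∉ pre n j := by simp [mem_pre]
    have hpos : 0 < y ⟨j, hjn⟩ := by linarith
    rw [pre_succ hjn, Finset.sum_insert hnot] at h3 ⊢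
    rw [Finset.prod_insert hnot]
    calc _ ≤ y ⟨j, hjn⟩ ^ m ⟨j, hjn⟩ * y ⟨j, hjn⟩ ^ (∑ i ∈ pre n j, m i) := by gcongr
      _ = y ⟨j, hjn⟩ ^ (m ⟨j, hjn⟩ + ∑ i ∈ pre n j, m i) := by rw [zpow_add₀ hpos.ne']
      _ ≤ Y0 ^ (m ⟨j, hjn⟩ + ∑ i ∈ pre n j, m i) := by
        obtain ⟨a, ha⟩ : ∃ a : ℕ, m ⟨j, hjn⟩ + ∑ i ∈ pre n j, m i = -(a : ℤ) :=
          ⟨(-(m ⟨j, hjn⟩ + ∑ i ∈ pre n j, m i)).toNat, by omega⟩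
        rw [ha, zpow_neg, zpow_neg, zpow_natCast, zpow_natCast]
        gcongr

lemma uvt_mem {n : ℕ} (j : ℕ) {p : Pt n} (hp : p ∈ GrowthSector n) :
    uvt n j p ∈ ClosedPolydisk n := by
  intro k
  unfold uvt
  split_ifs with h
  · simp
  · simp only [uv]
    have h1 : Real.exp (-(2 * Real.pi * p.2 k)) ≤ 1 := by
      rw [Real.exp_le_one_iff]
      have := hp.2.2 k
      have := Real.pi_pos
      have : 0 ≤ 2 * Real.pi * p.2 k := by positivity
      linarith
    have h2 := Real.exp_pos (-(2 * Real.pi * p.2 k))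
    have h3 := Real.sin_sq_add_cos_sq (2 * Real.pi * p.1 k)
    calc _ = Real.exp (-(2 * Real.pi * p.2 k)) ^ 2 *
        (Real.sin (2 * Real.pi * p.1 k) ^ 2 + Real.cos (2 * Real.pi * p.1 k) ^ 2) := by ring
      _ ≤ 1 := by rw [h3, mul_one]; exact pow_le_one₀ h2.le h1

lemma uvt_zero {n : ℕ} (p : Pt n) : uvt n 0 p = uv n p := by
  funext k; simp [uvt]

lemma uvt_dist {n : ℕ} (j : ℕ) (hj : j < n) (p : Pt n) :
    dist (uvt n j p) (uvt n (j + 1) p) ≤ Real.exp (-(p.2 ⟨j, hj⟩)) * 1 ∨ ¬ (0 < p.2 ⟨j, hj⟩) := by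
  by_cases hpos : 0 < p.2 ⟨j, hj⟩
  swap
  · exact Or.inr hpos
  left
  rw [dist_pi_le_iff (by positivity)]
  intro k
  unfold uvt
  by_cases h : (k : ℕ) < j
  · rw [if_pos h, if_pos (by omega), dist_self]; positivity
  by_cases h' : (k : ℕ) = j
  · obtain rfl : k = ⟨j, hj⟩ := Fin.ext h'
    rw [if_neg h, if_pos (by simp), dist_zero_right, Prod.norm_def]
    have hexp : Real.exp (-(2 * Real.pi * p.2 ⟨j, hj⟩)) ≤ Real.exp (-(p.2 ⟨j, hj⟩)) := by
      apply Real.exp_le_exp.2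
      have := Real.pi_gt_three
      nlinarith
    simp only [uv]
    refine max_le ?_ ?_ <;> rw [Real.norm_eq_abs, abs_mul, abs_of_pos (Real.exp_pos _)]
    · exact mul_le_mul hexp (Real.abs_cos_le_one _) (abs_nonneg _) (Real.exp_pos _).le
    · exact mul_le_mul hexp (Real.abs_sin_le_one _) (abs_nonneg _) (Real.exp_pos _).le
  · rw [if_neg h, if_neg (by omega), dist_self]; positivity

lemma prod_x {n : ℕ} {p : Pt n} (hp : p ∈ GrowthSector n) (K : Fin n → ℕ) :
    |∏ k, p.1 k ^ K k| ≤ 1 := by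
  rw [Finset.abs_prod]
  refine Finset.prod_le_one (fun _ _ => abs_nonneg _) fun k _ => ?_
  have := hp.1 k
  rw [abs_pow, abs_of_pos this.1]
  exact pow_le_one₀ this.1.le this.2.le

lemma y_exp_bound (N : ℕ) (y : ℝ) (hy : 0 ≤ y) : y ^ N * Real.exp (-y) ≤ N.factorial := by
  have h := Real.pow_div_factorial_le_exp y hy N
  have hf : (0 : ℝ) < N.factorial := by positivity
  rw [div_le_iff₀ hf] at h
  rw [Real.exp_neg, ← div_eq_mul_inv, div_le_iff₀ (Real.exp_pos _)]
  linarith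

lemma prod_y {n : ℕ} {p : Pt n} (hp : p ∈ GrowthSector n) (M : Fin n → ℤ) (j : ℕ) (hj : j < n)
    (hm : ∀ l ≤ j, ∑ i ∈ pre n l, M i ≤ 0) :
    ∏ k, p.2 k ^ M k ≤ p.2 ⟨j, hj⟩ ^ (∑ k, (M k).natAbs) := by
  have hpos : ∀ k, 0 < p.2 k := fun k => by linarith [hp.2.2 k]
  have h1 : ∀ k, 1 ≤ p.2 k := fun k => (hp.2.2 k).le
  have e1 := Finset.prod_filter_mul_prod_filter_not (Finset.univ : Finset (Fin n))
    (fun i => (i : ℕ) < j) (fun k => p.2 k ^ M k)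
  have b1 := abel_bound p.2 M hp.2.1 h1 j hj.le hm 1 le_rfl (fun i _ => h1 i)
  rw [one_zpow] at b1
  change (∏ i ∈ pre n j, p.2 i ^ M i) * _ = _ at e1
  rw [← e1]
  calc _ ≤ 1 * ∏ k ∈ Finset.univ.filter (fun i : Fin n => ¬ (i : ℕ) < j), p.2 ⟨j, hj⟩ ^ (M k).natAbs := by
        refine mul_le_mul b1 ?_ (Finset.prod_nonneg fun k _ => (zpow_pos (hpos k) _).le) zero_le_one
        refine Finset.prod_le_prod (fun k _ => (zpow_pos (hpos k) _).le) fun k hk => ?_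
        have hk' : j ≤ k := by simpa using hk
        calc p.2 k ^ M k ≤ p.2 k ^ ((M k).natAbs : ℤ) := zpow_le_zpow_right₀ (h1 k) (by omega)
          _ = p.2 k ^ (M k).natAbs := zpow_natCast _ _
          _ ≤ _ := pow_le_pow_left₀ (hpos k).le (hp.2.1 _ _ (Fin.le_def.2 hk')) _
    _ ≤ _ := by
      rw [one_mul, Finset.prod_pow_eq_pow_sum]
      exact pow_le_pow_right₀ (h1 _) (Finset.sum_le_sum_of_subset (Finset.filter_subset _ _))

/-- The truncated sum. -/
def FS {ι : Type*} (n : ℕ) (T : Finset ι) (r : ι → (Fin n → ℝ × ℝ) → ℝ) (K : ι → Fin n → ℕ)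
    (M : ι → Fin n → ℤ) (j : ℕ) (p : Pt n) : ℝ :=
  ∑ t ∈ T, r t (uvt n j p) * (∏ k, p.1 k ^ K t k) * ∏ k, p.2 k ^ M t k

lemma FS_step {ι : Type*} {n : ℕ} (T : Finset ι) (r : ι → (Fin n → ℝ × ℝ) → ℝ)
    (K : ι → Fin n → ℕ) (M : ι → Fin n → ℤ)
    (hr : ∀ t ∈ T, ∃ L, LipschitzOnWith L (r t) (ClosedPolydisk n)) (j : ℕ) (hj : j < n)
    (hm : ∀ t ∈ T, ∀ l ≤ j, ∑ i ∈ pre n l, M t i ≤ 0) :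
    ∃ C, ∀ p ∈ GrowthSector n, |FS n T r K M j p - FS n T r K M (j + 1) p| ≤ C := by
  have h : ∀ t : ι, ∃ C, t ∈ T → ∀ p ∈ GrowthSector n,
      |r t (uvt n j p) * (∏ k, p.1 k ^ K t k) * ∏ k, p.2 k ^ M t k -
      r t (uvt n (j + 1) p) * (∏ k, p.1 k ^ K t k) * ∏ k, p.2 k ^ M t k| ≤ C := by
    intro t
    by_cases ht : t ∈ T
    swap
    · exact ⟨0, fun h => absurd h ht⟩
    obtain ⟨L, hL⟩ := hr t ht
    refine ⟨L * (∑ k, (M t k).natAbs).factorial, fun _ p hp => ?_⟩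
    have hpos : 0 < p.2 ⟨j, hj⟩ := by linarith [hp.2.2 ⟨j, hj⟩]
    rw [← sub_mul, ← sub_mul, abs_mul, abs_mul]
    have h1 : |r t (uvt n j p) - r t (uvt n (j + 1) p)| ≤ L * Real.exp (-(p.2 ⟨j, hj⟩)) := by
      have := hL.dist_le_mul _ (uvt_mem j hp) _ (uvt_mem (j + 1) hp)
      rw [Real.dist_eq] at this
      refine this.trans ?_
      have h2 := (uvt_dist j hj p).resolve_right (not_not.2 hpos)
      rw [mul_one] at h2
      gcongr
    have h2 := prod_x hp (K t)
    have h3 : |∏ k, p.2 k ^ M t k| ≤ p.2 ⟨j, hj⟩ ^ (∑ k, (M t k).natAbs) := by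
      rw [abs_of_nonneg (Finset.prod_nonneg fun k _ => zpow_nonneg (by linarith [hp.2.2 k]) _)]
      exact prod_y hp _ j hj (hm t ht)
    have h4 := y_exp_bound (∑ k, (M t k).natAbs) (p.2 ⟨j, hj⟩) hpos.le
    calc _ ≤ (L * Real.exp (-(p.2 ⟨j, hj⟩))) * 1 * p.2 ⟨j, hj⟩ ^ (∑ k, (M t k).natAbs) := by gcongr
      _ = L * (p.2 ⟨j, hj⟩ ^ (∑ k, (M t k).natAbs) * Real.exp (-(p.2 ⟨j, hj⟩))) := by ring
      _ ≤ _ := by gcongr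
  choose C hC using h
  refine ⟨∑ t ∈ T, C t, fun p hp => ?_⟩
  unfold FS
  rw [← Finset.sum_sub_distrib]
  exact (Finset.abs_sum_le_sum_abs _ _).trans (Finset.sum_le_sum fun t ht => hC t ht p hp)

/-- The strict sector. -/
def Strict (n : ℕ) : Set (Pt n) :=
  {p | p ∈ GrowthSector n ∧ ∀ k l : Fin n, k < l → p.2 l < p.2 k}

lemma path_strict {n : ℕ} {p : Pt n} (hp : p ∈ Strict n) (e : Fin n → ℕ)
    (he : ∀ k l : Fin n, k ≤ l → e l ≤ e k) (σ : ℝ) (hσ : 0 ≤ σ) :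
    ((p.1, fun k => p.2 k + e k * σ) : Pt n) ∈ Strict n := by
  refine ⟨⟨hp.1.1, fun k l hkl => ?_, fun k => ?_⟩, fun k l hkl => ?_⟩
  · have h1 := hp.1.2.1 k l hkl
    have h2 : (e l : ℝ) ≤ e k := by exact_mod_cast he k l hkl
    have := mul_le_mul_of_nonneg_right h2 hσ
    simp only; linarith
  · have h1 := hp.1.2.2 k
    have : (0 : ℝ) ≤ e k * σ := by positivity
    simp only; linarith
  · have h1 := hp.2 k l hkl
    have h2 : (e l : ℝ) ≤ e k := by exact_mod_cast he k l hkl.le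
    have := mul_le_mul_of_nonneg_right h2 hσ
    simp only; linarith

lemma main_strict {ι : Type*} {n : ℕ} (T : Finset ι) (r : ι → (Fin n → ℝ × ℝ) → ℝ)
    (K : ι → Fin n → ℕ) (M : ι → Fin n → ℤ)
    (hr : ∀ t ∈ T, ∃ L, LipschitzOnWith L (r t) (ClosedPolydisk n))
    (hyp : ∀ nhat : ℕ, 1 ≤ nhat → nhat ≤ n → ∀ e : Fin n → ℕ,
      (∀ k l : Fin n, k ≤ l → e l ≤ e k) → (∀ k : Fin n, (k : ℕ) < nhat → 0 < e k) →
      (∀ k : Fin n, nhat ≤ (k : ℕ) → e k = 0) → ∀ p ∈ Strict n,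
      ∃ C, ∀ σ : ℝ, 0 ≤ σ → |FS n T r K M 0 (p.1, fun k => p.2 k + e k * σ)| ≤ C) :
    ∃ C, ∀ p ∈ Strict n, |FS n T r K M 0 p| ≤ C := by
  classical
  set Tj : ℕ → Finset ι := fun j => T.filter fun t => ∀ l ≤ j, ∑ i ∈ pre n l, M t i ≤ 0 with hTj
  have main : ∀ j ≤ n, ∃ C, ∀ p ∈ Strict n,
      |FS n T r K M 0 p - FS n (Tj j) r K M j p| ≤ C := by
    intro j
    induction j with
    | zero =>
      intro _
      refine ⟨0, fun p _ => ?_⟩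
      have : Tj 0 = T := by
        simp only [hTj]
        refine Finset.filter_true_of_mem fun t _ l hl => ?_
        obtain rfl : l = 0 := by omega
        simp [pre]
      rw [this, sub_self, abs_zero]
    | succ j ih =>
      intro hj
      have hjn : j < n := hj
      obtain ⟨C1, hC1⟩ := ih hjn.le
      obtain ⟨C2, hC2⟩ := FS_step (Tj j) r K M
        (fun t ht => hr t (Finset.mem_filter.1 ht).1) j hjn
        (fun t ht => (Finset.mem_filter.1 ht).2)
      have hC3 : ∀ p ∈ Strict n, |FS n T r K M 0 p - FS n (Tj j) r K M (j + 1) p| ≤ C1 + C2 := by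
        intro p hp
        exact (abs_sub_le _ (FS n (Tj j) r K M j p) _).trans
          (add_le_add (hC1 p hp) (hC2 p hp.1))
      refine ⟨C1 + C2, fun p hp => ?_⟩
      have heq : FS n (Tj j) r K M (j + 1) p = FS n (Tj (j + 1)) r K M (j + 1) p := by
        set A : ι → ℝ := fun t => r t (uvt n (j + 1) p) * (∏ k, p.1 k ^ K t k) *
          ∏ k ∈ Finset.univ.filter (fun i : Fin n => ¬ (i : ℕ) < j + 1), p.2 k ^ M t k with hA
        have split : ∀ y : Fin n → ℝ, (∀ k : Fin n, ¬ (k : ℕ) < j + 1 → y k = p.2 k) →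
            ∀ t, r t (uvt n (j + 1) (p.1, y)) * (∏ k, p.1 k ^ K t k) * ∏ k, y k ^ M t k =
            A t * ∏ i ∈ pre n (j + 1), y i ^ M t i := by
          intro y hy t
          have e1 := Finset.prod_filter_mul_prod_filter_not (Finset.univ : Finset (Fin n))
            (fun i => (i : ℕ) < j + 1) (fun k => y k ^ M t k)
          have e2 : ∏ k ∈ Finset.univ.filter (fun i : Fin n => ¬ (i : ℕ) < j + 1), y k ^ M t k =
              ∏ k ∈ Finset.univ.filter (fun i : Fin n => ¬ (i : ℕ) < j + 1), p.2 k ^ M t k := by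
            refine Finset.prod_congr rfl fun k hk => ?_
            rw [hy k (Finset.mem_filter.1 hk).2]
          have e3 : uvt n (j + 1) (p.1, y) = uvt n (j + 1) p := by
            funext k
            unfold uvt
            split_ifs with h
            · rfl
            · simp only [uv, hy k h]
          rw [← e1, e2, e3, hA]
          simp only [pre]
          ring
        have hk := key (pre n (j + 1)) (Tj j) A M p.2 (fun k _ => hp.1.2.2 k)
          (fun k _ l _ => hp.1.2.1 k l) ?_
        · have hsp := split p.2 (fun _ _ => rfl)
          unfold FS
          have hsub : Tj (j + 1) = (Tj j).filter fun t => ¬ 0 < ∑ i ∈ pre n (j + 1), M t i := by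
            simp only [hTj]
            ext t
            simp only [Finset.mem_filter, not_lt]
            constructor
            · rintro ⟨a, b⟩
              exact ⟨⟨a, fun l hl => b l (by omega)⟩, b _ le_rfl⟩
            · rintro ⟨⟨a, b⟩, c⟩
              refine ⟨a, fun l hl => ?_⟩
              rcases Nat.lt_or_ge l (j + 1) with h | h
              · exact b l (by omega)
              · obtain rfl : l = j + 1 := by omega
                exact c
          rw [← Finset.sum_filter_add_sum_filter_not (Tj j)
            (fun t => 0 < ∑ i ∈ pre n (j + 1), M t i), ← hsub]
          rw [Finset.sum_congr rfl (fun t _ => hsp t), hk, zero_add]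
        · intro e he0 hea
          set e' : Fin n → ℕ := fun k => if (k : ℕ) < j + 1 then e k else 0 with he'
          have ha' : ∀ k l : Fin n, k ≤ l → e' l ≤ e' k := by
            intro k l hkl
            have : (k : ℕ) ≤ l := hkl
            simp only [he']
            split_ifs with h1 h2
            · exact hea k (mem_pre.2 h2) l (mem_pre.2 h1) hkl
            · omega
            · exact Nat.zero_le _
            · exact le_rfl
          obtain ⟨C, hC⟩ := hyp (j + 1) (by omega) hj e' ha'
            (fun k hk => by simp only [he', if_pos hk]; exact he0 k (mem_pre.2 hk))
            (fun k hk => by simp only [he']; rw [if_neg (by omega)]) p hp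
          refine ⟨C + (C1 + C2), fun σ hσ => ?_⟩
          have h1 := hC σ hσ
          have h2 := hC3 _ (path_strict hp e' ha' σ hσ)
          have h3 : FS n (Tj j) r K M (j + 1) (p.1, fun k => p.2 k + e' k * σ) =
              ∑ t ∈ Tj j, A t * ∏ i ∈ pre n (j + 1), (p.2 i + e i * σ) ^ M t i := by
            unfold FS
            refine Finset.sum_congr rfl fun t _ => ?_
            simp only
            rw [split (fun k => p.2 k + e' k * σ) (fun k hk => by simp only [he']; rw [if_neg hk]; simp) t]
            congr 1
            refine Finset.prod_congr rfl fun i hi => ?_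
            simp only [he', if_pos (mem_pre.1 hi)]
          rw [← h3]
          rw [abs_le] at h1 h2 ⊢
          constructor <;> linarith [h1.1, h1.2, h2.1, h2.2]
      rw [← heq]
      exact hC3 p hp
  obtain ⟨C, hC⟩ := main n le_rfl
  refine ⟨C + ∑ t ∈ Tj n, |r t 0|, fun p hp => ?_⟩
  have h1 := hC p hp
  have h2 : |FS n (Tj n) r K M n p| ≤ ∑ t ∈ Tj n, |r t 0| := by
    refine (Finset.abs_sum_le_sum_abs _ _).trans (Finset.sum_le_sum fun t ht => ?_)
    have e0 : uvt n n p = 0 := by funext k; simp [uvt]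
    rw [abs_mul, abs_mul, e0]
    have hx := prod_x hp.1 (K t)
    have hy : |∏ k, p.2 k ^ M t k| ≤ 1 := by
      rw [abs_of_nonneg (Finset.prod_nonneg fun k _ => zpow_nonneg (by linarith [hp.1.2.2 k]) _)]
      have := abel_bound p.2 (M t) hp.1.2.1 (fun k => (hp.1.2.2 k).le) n le_rfl
        (Finset.mem_filter.1 ht).2 1 le_rfl (fun i _ => (hp.1.2.2 i).le)
      rw [one_zpow] at this
      have hu : pre n n = Finset.univ := by ext i; simp [mem_pre]
      rwa [hu] at this
    calc _ ≤ |r t 0| * 1 * 1 := by gcongr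
      _ = _ := by ring
  rw [abs_le] at h1 h2 ⊢
  constructor <;> linarith [h1.1, h1.2, h2.1, h2.2]

lemma extend_bound {ι : Type*} {n : ℕ} (T : Finset ι) (r : ι → (Fin n → ℝ × ℝ) → ℝ)
    (K : ι → Fin n → ℕ) (M : ι → Fin n → ℤ)
    (hr : ∀ t ∈ T, ContinuousOn (r t) (ClosedPolydisk n)) (C : ℝ)
    (hC : ∀ p ∈ Strict n, |FS n T r K M 0 p| ≤ C) :
    ∀ p ∈ GrowthSector n, |FS n T r K M 0 p| ≤ C := by
  intro p hp
  set q : ℝ → Pt n := fun ε => (p.1, fun k => p.2 k + ε * (n - (k : ℕ) : ℝ)) with hq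
  have hq0 : q 0 = p := by simp [hq]
  have hqc : Continuous q := by
    simp only [hq]; fun_prop
  have hqS : ∀ ε > 0, q ε ∈ Strict n := by
    intro ε hε
    have hlt : ∀ k l : Fin n, k < l → p.2 l + ε * (n - (l : ℕ) : ℝ) < p.2 k + ε * (n - (k : ℕ) : ℝ) := by
      intro k l hkl
      have h1 := hp.2.1 k l hkl.le
      have h2 : ((k : ℕ) : ℝ) < (l : ℕ) := by exact_mod_cast hkl
      nlinarith
    refine ⟨⟨hp.1, fun k l hkl => ?_, fun k => ?_⟩, hlt⟩
    · rcases hkl.eq_or_lt with rfl | h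
      · exact le_rfl
      · exact (hlt k l h).le
    · have h2 : ((k : ℕ) : ℝ) < n := by exact_mod_cast k.2
      have h1 := hp.2.2 k
      simp only [hq]
      nlinarith
  have hqG : ∀ ε ∈ Set.Ici (0:ℝ), q ε ∈ GrowthSector n := by
    intro ε hε
    rcases (show (0:ℝ) ≤ ε from hε).eq_or_lt with rfl | h
    · rw [hq0]; exact hp
    · exact (hqS ε h).1
  have hcont : ContinuousOn (fun ε => |FS n T r K M 0 (q ε)|) (Set.Ici 0) := by
    refine ContinuousOn.abs ?_
    unfold FS
    refine continuousOn_finsetSum _ fun t ht => ?_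
    refine ContinuousOn.mul (ContinuousOn.mul ?_ ?_) ?_
    · refine (hr t ht).comp ?_ (fun ε hε => uvt_mem 0 (hqG ε hε))
      simp_rw [uvt_zero]
      unfold uv
      apply Continuous.continuousOn
      fun_prop
    · apply Continuous.continuousOn; fun_prop
    · refine continuousOn_finsetProd _ fun k _ => ?_
      refine ContinuousOn.zpow₀ (by apply Continuous.continuousOn; fun_prop) _ fun ε hε => Or.inl ?_
      have := (hqG ε hε).2.2 k
      linarith
  have hlim : Filter.Tendsto (fun ε => |FS n T r K M 0 (q ε)|) (nhdsWithin 0 (Set.Ioi 0))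
      (nhds |FS n T r K M 0 p|) := by
    have := (hcont 0 Set.self_mem_Ici).mono Set.Ioi_subset_Ici_self
    have h2 := this.tendsto
    rwa [hq0] at h2
  refine le_of_tendsto hlim ?_
  filter_upwards [self_mem_nhdsWithin] with ε hε
  exact hC _ (hqS ε hε)

lemma monGrowth_abs {n : ℕ} {f : Pt n → ℝ} (h : MonGrowth n f) :
    ∃ m : Fin n → ℤ, ∃ c C : ℝ, 0 < c ∧ 0 < C ∧ ∀ p ∈ GrowthSector n,
      c * monomial n m p ≤ |f p| ∧ |f p| ≤ C * monomial n m p := by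
  obtain ⟨m, C₁, C₂, hpos, hb⟩ := h
  rcases pos_and_pos_or_neg_and_neg_of_mul_pos hpos with ⟨h1, h2⟩ | ⟨h1, h2⟩
  · refine ⟨m, C₁, C₂, h1, h2, fun p hp => ?_⟩
    have := hb p hp
    have hm : 0 < monomial n m p :=
      Finset.prod_pos fun k _ => zpow_pos (by linarith [hp.2.2 k]) _
    have : 0 < f p := by nlinarith [mul_pos h1 hm]
    rw [abs_of_pos this]
    constructor <;> linarith
  · refine ⟨m, -C₂, -C₁, by linarith, by linarith, fun p hp => ?_⟩
    have := hb p hp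
    have hm : 0 < monomial n m p :=
      Finset.prod_pos fun k _ => zpow_pos (by linarith [hp.2.2 k]) _
    have : f p < 0 := by nlinarith [mul_pos (neg_pos.2 h2) hm]
    rw [abs_of_neg this]
    constructor <;> linarith

/-- Curve-reduction lemma using BPS strings. Let `f` be
polynomially tamed and `g` monomially tamed on `Σ_n`. If `|f| ≺ |g|` on every
string-backreaction path set in `P_e^{(n̂)}` (charges `e¹ ≥ ⋯ ≥ e^{n̂} > 0`,
`e^{n̂+1} = ⋯ = eⁿ = 0`, base points with `s₀¹ > ⋯ > s₀ⁿ > 1`, `0 < a₀ᵏ < 1`)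
for every `1 ≤ n̂ ≤ n`, then `|f| ≺ |g|` on all of `Σ_n`. -/
theorem statement1 (n : ℕ) (hn : 1 ≤ n) (f g : Pt n → ℝ)
    (hf : PolyTamed n f) (hg : MonTamed n g)
    (hyp : ∀ nhat : ℕ, 1 ≤ nhat → nhat ≤ n →
      ∀ e : Fin n → ℕ,
        (∀ k l : Fin n, k ≤ l → (l : ℕ) < nhat → e l ≤ e k) →
        (∀ k : Fin n, (k : ℕ) < nhat → 0 < e k) →
        (∀ k : Fin n, nhat ≤ (k : ℕ) → e k = 0) →
      ∀ a₀ s₀ : Fin n → ℝ,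
        (∀ k, 0 < a₀ k ∧ a₀ k < 1) →
        (∀ k l : Fin n, k < l → s₀ l < s₀ k) →
        (∀ k, 1 < s₀ k) →
        Prec (GrowthSector n ∩ StringPathSet n e a₀ s₀)
          (fun p => |f p|) (fun p => |g p|)) :
    Prec (GrowthSector n) (fun p => |f p|) (fun p => |g p|) := by
  classical
  obtain ⟨G, H, hG, hH, hH0, hfe⟩ := hf
  obtain ⟨T, ρ, hρ, hGe⟩ := hG
  obtain ⟨mH, cH, CH, hcH, hCH, hHb⟩ := monGrowth_abs hH.2
  obtain ⟨mg, cg, Cg, hcg, hCg, hgb⟩ := monGrowth_abs hg.2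
  have hmpos : ∀ m : Fin n → ℤ, ∀ p ∈ GrowthSector n, 0 < monomial n m p := fun m p hp =>
    Finset.prod_pos fun k _ => zpow_pos (by linarith [hp.2.2 k]) _
  have hex : ∀ km, ∃ r, km ∈ T → RestrictedAnalytic n r ∧
      ∀ p ∈ GrowthSector n, ρ km p = r (uv n p) := by
    intro km
    by_cases h : km ∈ T
    · obtain ⟨r, h1, h2⟩ := hρ km h
      exact ⟨r, fun _ => ⟨h1, h2⟩⟩
    · exact ⟨0, fun h' => absurd h' h⟩
  choose r hr using hex
  set M : ((Fin n → ℕ) × (Fin n → ℤ)) → Fin n → ℤ := fun km k => km.2 k - mH k - mg k with hM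
  set K : ((Fin n → ℕ) × (Fin n → ℤ)) → Fin n → ℕ := fun km => km.1 with hK
  have hlip : ∀ t ∈ T, ∃ L, LipschitzOnWith L (r t) (ClosedPolydisk n) :=
    fun t ht => restricted_lip (hr t ht).1
  have hFS : ∀ p ∈ GrowthSector n,
      G p = FS n T r K M 0 p * (monomial n mH p * monomial n mg p) := by
    intro p hp
    rw [hGe p hp]
    unfold FS
    rw [Finset.sum_mul]
    refine Finset.sum_congr rfl fun t ht => ?_
    rw [(hr t ht).2 p hp, uvt_zero, mul_assoc _ _ (monomial n mH p * monomial n mg p)]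
    congr 1
    unfold monomial
    rw [← Finset.prod_mul_distrib, ← Finset.prod_mul_distrib]
    refine Finset.prod_congr rfl fun k _ => ?_
    have : p.2 k ≠ 0 := by linarith [hp.2.2 k]
    rw [← zpow_add₀ this, ← zpow_add₀ this]
    congr 1
    simp only [hM]
    ring
  have hup : ∀ p ∈ GrowthSector n, |f p| * (cH * cg) ≤ |FS n T r K M 0 p| * |g p| := by
    intro p hp
    have h1 := hHb p hp
    have h2 := hgb p hp
    have m1 := hmpos mH p hp
    have m2 := hmpos mg p hp
    have hHp : 0 < |H p| := abs_pos.2 (hH0 p hp)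
    rw [hfe p hp, abs_div, hFS p hp, abs_mul, abs_of_pos (mul_pos m1 m2), div_mul_eq_mul_div,
      div_le_iff₀ hHp]
    have : (cH * monomial n mH p) * (cg * monomial n mg p) ≤ |H p| * |g p| :=
      mul_le_mul h1.1 h2.1 (by positivity) (by positivity)
    have h3 := mul_le_mul_of_nonneg_left this (abs_nonneg (FS n T r K M 0 p))
    linarith
  have hdown : ∀ p ∈ GrowthSector n, ∀ C, 0 < C → |f p| < C * |g p| →
      |FS n T r K M 0 p| ≤ C * CH * Cg := by
    intro p hp C hC hlt
    have h1 := hHb p hp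
    have h2 := hgb p hp
    have m1 := hmpos mH p hp
    have m2 := hmpos mg p hp
    have hHp : 0 < |H p| := abs_pos.2 (hH0 p hp)
    rw [hfe p hp, abs_div, hFS p hp, abs_mul, abs_of_pos (mul_pos m1 m2), div_lt_iff₀ hHp] at hlt
    have : |H p| * |g p| ≤ (CH * monomial n mH p) * (Cg * monomial n mg p) :=
      mul_le_mul h1.2 h2.2 (by positivity) (by positivity)
    have h3 := mul_le_mul_of_nonneg_left this hC.le
    refine le_of_mul_le_mul_right ?_ (mul_pos m1 m2)
    linarith
  obtain ⟨C, hC⟩ := main_strict T r K M hlip (by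
    intro nhat h1 h2 e he hepos he0 p hp
    obtain ⟨C, hC, hb⟩ := hyp nhat h1 h2 e (fun k l hkl _ => he k l hkl) hepos he0 p.1 p.2
      hp.1.1 hp.2 hp.1.2.2
    refine ⟨C * CH * Cg, fun σ hσ => ?_⟩
    have hm := (path_strict hp e he σ hσ).1
    refine hdown _ hm C hC (hb _ ⟨hm, ⟨σ * Complex.I, by simpa using hσ, fun k => ?_⟩⟩)
    push_cast
    ring)
  have hC' := extend_bound T r K M (fun t ht => by
    obtain ⟨L, hL⟩ := hlip t ht
    exact hL.continuousOn) C hC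
  refine ⟨(|C| + 1) / (cH * cg), by positivity, fun p hp => ?_⟩
  have h1 := hup p hp
  have h2 := hC' p hp
  have hgp : 0 < |g p| := lt_of_lt_of_le (mul_pos hcg (hmpos mg p hp)) (hgb p hp).1
  have hcc : 0 < cH * cg := mul_pos hcH hcg
  simp only
  rw [div_mul_eq_mul_div, lt_div_iff₀ hcc]
  refine lt_of_le_of_lt h1 (mul_lt_mul_of_pos_right ?_ hgp)
  linarith [le_abs_self C]

end

end TamePaper
end

section
/- Let s = (s_1, …, s_n) ∈ ℤ^n. The monomial function (y^1)^{s_1}⋯(y^n)^{s_n} is bounded on Σ_n (equivalently, (y^1)^{s_1}⋯(y^n)^{s_n} ≺ 1 on Σ_n) if and only if the partial sums satisfy s_1 + s_2 + ⋯ + s_k ≤ 0 for every k ∈ {1, …, n}. -/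
namespace TamePaper

noncomputable section

theorem aux (n : ℕ) : ∀ (s : Fin (n+1) → ℤ) (y : Fin (n+1) → ℝ),
    (∀ k l, k ≤ l → y l ≤ y k) → (∀ k, 1 < y k) →
    (∀ k : Fin (n+1), (∑ i ∈ Finset.univ.filter (fun i => i ≤ k), s i) ≤ 0) →
    ∏ k, y k ^ s k ≤ y (Fin.last n) ^ (∑ i, s i) := by
  induction n with
  | zero => intro s y _ _ _; simp
  | succ n ih =>
    intro s y hy h1 hs
    have hs' : ∀ k : Fin (n+1),
        (∑ i ∈ Finset.univ.filter (fun i => i ≤ k), s i.castSucc) ≤ 0 := by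
      intro k
      have h := hs k.castSucc
      rw [Finset.sum_filter, Fin.sum_univ_castSucc] at h
      rw [Finset.sum_filter]
      have hk : ¬ (Fin.last (n+1) ≤ k.castSucc) := not_le.mpr (Fin.castSucc_lt_last k)
      simpa [hk] using h
    have hi := ih (fun i => s i.castSucc) (fun i => y i.castSucc)
      (fun k l h => hy _ _ (Fin.castSucc_le_castSucc_iff.mpr h)) (fun k => h1 _) hs'
    have hS : (∑ i : Fin (n+1), s i.castSucc) ≤ 0 := by
      have h := hs' (Fin.last n)
      simpa [Fin.le_last] using h
    have hpos : 0 < y (Fin.last (n+1)) := lt_trans one_pos (h1 _)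
    rw [Fin.prod_univ_castSucc, Fin.sum_univ_castSucc, zpow_add₀ hpos.ne']
    refine mul_le_mul_of_nonneg_right (hi.trans ?_) (zpow_pos hpos _).le
    obtain ⟨m, hm⟩ := Int.exists_eq_neg_ofNat hS
    rw [hm, zpow_neg, zpow_neg, zpow_natCast, zpow_natCast]
    exact inv_anti₀ (pow_pos hpos _) (pow_le_pow_left₀ hpos.le (hy _ _ (Fin.le_last _)) _)

/-- The monomial `(y¹)^{s₁}⋯(yⁿ)^{sₙ}` is bounded on `Σ_n`
(equivalently `≺ 1` on `Σ_n`) if and only if all partial sums satisfy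
`s₁ + ⋯ + s_k ≤ 0` for every `k ∈ {1, …, n}`. -/
theorem statement3 (n : ℕ) (hn : 1 ≤ n) (s : Fin n → ℤ) :
    Prec (GrowthSector n) (monomial n s) (fun _ => 1) ↔
      ∀ k : Fin n, (∑ i ∈ Finset.univ.filter (fun i : Fin n => i ≤ k), s i) ≤ 0 := by
  constructor
  · rintro ⟨C, hC, h⟩ k
    by_contra! hk
    set D : ℝ := ∏ i ∈ Finset.univ.filter (fun i : Fin n => ¬ i ≤ k), (2:ℝ) ^ s i with hD
    have hDpos : 0 < D := Finset.prod_pos fun i _ => zpow_pos two_pos _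
    set T : ℝ := max 2 (C / D) with hT
    have hT2 : 2 ≤ T := le_max_left _ _
    have hTC : C ≤ T * D := by
      rw [← div_le_iff₀ hDpos]; exact le_max_right _ _
    have h' := h (fun _ => 1/2, fun i => if i ≤ k then T else 2) (by
      refine ⟨fun _ => by norm_num, fun a b hab => ?_, fun a => ?_⟩
      · dsimp only
        split_ifs with hb ha ha
        · exact le_rfl
        · exact absurd (hab.trans hb) ha
        · exact hT2
        · exact le_rfl
      · dsimp only
        split_ifs <;> linarith)
    have hT0 : T ≠ 0 := by linarith
    have hm : monomial n s (fun _ => 1/2, fun i => if i ≤ k then T else 2)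
        = T ^ (∑ i ∈ Finset.univ.filter (fun i : Fin n => i ≤ k), s i) * D := by
      unfold monomial
      rw [← Finset.prod_filter_mul_prod_filter_not Finset.univ (fun i : Fin n => i ≤ k)]
      congr 1
      · have hz : ∀ A : Finset (Fin n), T ^ (∑ i ∈ A, s i) = ∏ i ∈ A, T ^ s i := by
          intro A
          induction A using Finset.induction_on with
          | empty => simp
          | insert a A ha ih => rw [Finset.sum_insert ha, Finset.prod_insert ha, zpow_add₀ hT0, ih]
        rw [hz]
        refine Finset.prod_congr rfl fun i hi => ?_
        simp [(Finset.mem_filter.mp hi).2]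
      · refine Finset.prod_congr rfl fun i hi => ?_
        simp only [if_neg (Finset.mem_filter.mp hi).2]
    rw [hm] at h'
    have h1 : T ^ (1:ℤ) ≤ T ^ (∑ i ∈ Finset.univ.filter (fun i : Fin n => i ≤ k), s i) :=
      zpow_le_zpow_right₀ (by linarith) (by omega)
    rw [zpow_one] at h1
    have := mul_le_mul_of_nonneg_right h1 hDpos.le
    linarith
  · intro hs
    obtain ⟨m, rfl⟩ : ∃ m, n = m + 1 := ⟨n - 1, by omega⟩
    refine ⟨2, two_pos, fun p hp => ?_⟩
    have h := aux m s p.2 hp.2.1 hp.2.2 hs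
    have hS : (∑ i, s i) ≤ 0 := by
      have h := hs (Fin.last m)
      simpa [Fin.le_last] using h
    have h2 : p.2 (Fin.last m) ^ (∑ i, s i) ≤ 1 := zpow_le_one_of_nonpos₀ (hp.2.2 _).le hS
    unfold monomial
    linarith

end

end TamePaper
end

section
/- Let k, m ∈ ℤ^n. If the two monomial functions (y^1)^{k_1}⋯(y^n)^{k_n} and (y^1)^{m_1}⋯(y^n)^{m_n} satisfy (y^1)^{k_1}⋯(y^n)^{k_n} ∼ (y^1)^{m_1}⋯(y^n)^{m_n} on Σ_n, then k = m, i.e., k_i = m_i for every i. In particular, the exponent vector of a monomially tamed function is uniquely determined. -/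
namespace TamePaper

noncomputable section

theorem aux_bound (C : ℝ) (S D : ℤ) (h : ∀ N : ℕ, (2:ℝ) ^ ((N:ℤ) * S + D) < C) : S ≤ 0 := by
  obtain ⟨P, hP⟩ := pow_unbounded_of_one_lt C (one_lt_two : (1:ℝ) < 2)
  by_contra hS
  push Not at hS
  have h1 := (h (P + D.natAbs)).trans hP
  rw [← zpow_natCast, zpow_lt_zpow_iff_right₀ (one_lt_two : (1:ℝ) < 2)] at h1
  push_cast at h1
  have h2 : -|D| ≤ D := neg_abs_le D
  have h3 : 0 ≤ |D| := abs_nonneg D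
  have h4 : (0:ℤ) ≤ P := Int.natCast_nonneg P
  nlinarith

theorem aux_point (n : ℕ) (i : Fin n) (N : ℕ) (k : Fin n → ℤ) :
    monomial n k (fun _ => 1/2, fun j => (2:ℝ) ^ ((N:ℤ) * (if j ≤ i then 1 else 0) + 1)) =
      (2:ℝ) ^ ((N:ℤ) * (∑ j, if j ≤ i then k j else 0) + ∑ j, k j) := by
  have hs : ((N:ℤ) * (∑ j, if j ≤ i then k j else 0) + ∑ j, k j) =
      ∑ j, ((N:ℤ) * (if j ≤ i then 1 else 0) + 1) * k j := by
    rw [Finset.mul_sum, ← Finset.sum_add_distrib]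
    refine Finset.sum_congr rfl fun j _ => ?_
    split_ifs <;> ring
  have hp : ∀ (s : Finset (Fin n)) (f : Fin n → ℤ),
      (2:ℝ) ^ (∑ j ∈ s, f j) = ∏ j ∈ s, (2:ℝ) ^ f j := by
    intro s f
    induction s using Finset.induction_on with
    | empty => simp
    | insert a s ha ih =>
      rw [Finset.sum_insert ha, Finset.prod_insert ha, zpow_add₀ two_ne_zero, ih]
  rw [hs, hp]
  unfold monomial
  refine Finset.prod_congr rfl fun j _ => ?_
  rw [zpow_mul]

theorem aux_mem (n : ℕ) (i : Fin n) (N : ℕ) :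
    ((fun _ => 1/2, fun j => (2:ℝ) ^ ((N:ℤ) * (if j ≤ i then 1 else 0) + 1)) : Pt n)
      ∈ GrowthSector n := by
  refine ⟨fun _ => by norm_num, fun a b hab => ?_, fun j => ?_⟩
  · refine zpow_le_zpow_right₀ one_le_two ?_
    by_cases hb : b ≤ i
    · simp [hb, hab.trans hb]
    · simp only [hb, if_false]
      split_ifs <;> simp
  · refine one_lt_zpow₀ one_lt_two ?_
    split_ifs <;> simp <;> omega

theorem aux_sum (n : ℕ) (k m : Fin n → ℤ)
    (h : Sim (GrowthSector n) (monomial n k) (monomial n m)) (i : Fin n) :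
    (∑ j, if j ≤ i then k j else 0) = ∑ j, if j ≤ i then m j else 0 := by
  obtain ⟨C₁, C₂, hC, h⟩ := h
  have h' := fun N : ℕ => h _ (aux_mem n i N)
  simp only [aux_point] at h'
  generalize (∑ j, if j ≤ i then k j else 0) = A at *
  generalize (∑ j, if j ≤ i then m j else 0) = B at *
  generalize (∑ j, k j) = a at *
  generalize (∑ j, m j) = b at *
  have h2 : (0:ℝ) < 2 := two_pos
  have hC2 : 0 < C₂ := by
    have h0 := (h' 0).2
    exact pos_of_mul_pos_left ((zpow_pos h2 _).trans h0) (zpow_pos h2 _).le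
  have hC1 : 0 < C₁ := pos_of_mul_pos_left hC hC2.le
  apply le_antisymm
  · have := aux_bound C₂ (A - B) (a - b) fun N => by
      have e : (N:ℤ) * (A - B) + (a - b) = (N * A + a) - (N * B + b) := by ring
      rw [e, zpow_sub₀ h2.ne', div_lt_iff₀ (zpow_pos h2 _)]
      exact (h' N).2
    omega
  · have := aux_bound (1 / C₁) (B - A) (b - a) fun N => by
      have e : (N:ℤ) * (B - A) + (b - a) = (N * B + b) - (N * A + a) := by ring
      rw [e, zpow_sub₀ h2.ne', div_lt_div_iff₀ (zpow_pos h2 _) hC1]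
      linarith [(h' N).1]
    omega

/-- If two monomials `(y¹)^{k₁}⋯(yⁿ)^{kₙ}` and `(y¹)^{m₁}⋯(yⁿ)^{mₙ}`
satisfy `∼` on `Σ_n`, then their exponent vectors agree: `k = m`. In particular,
the exponent vector of a monomially tamed function is uniquely determined. -/
theorem statement4 (n : ℕ) (hn : 1 ≤ n) (k m : Fin n → ℤ)
    (h : Sim (GrowthSector n) (monomial n k) (monomial n m)) :
    k = m := by
  funext i
  induction i using WellFoundedLT.induction with
  | ind i ih =>
    have hs := aux_sum n k m h i
    rw [← sub_eq_zero, ← Finset.sum_sub_distrib, Finset.sum_eq_single i] at hs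
    · simpa [sub_eq_zero] using hs
    · intro j _ hj
      by_cases hji : j ≤ i
      · simp [hji, ih j (lt_of_le_of_ne hji hj)]
      · simp [hji]
    · simp

end

end TamePaper
end

section
/- For every natural number n, every natural number i with 0 ≤ i ≤ n, and every real number t, the sum ∑_{k=0}^{n} (−1)^k · C(n, k) · (t + k)^i equals 0 when i < n and equals (−1)^n · n! when i = n, where C(n, k) denotes the binomial coefficient. -/
/-- For every natural number `n`, every `0 ≤ i ≤ n`, and every real
`t`, the sum `∑_{k=0}^{n} (−1)^k C(n,k) (t+k)^i` equals `0` when `i < n` and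
`(−1)^n n!` when `i = n`. -/
theorem statement7 (n i : ℕ) (hi : i ≤ n) (t : ℝ) :
    (i < n →
      ∑ k ∈ Finset.range (n + 1), (-1 : ℝ) ^ k * (n.choose k : ℝ) * (t + k) ^ i = 0) ∧
    (i = n →
      ∑ k ∈ Finset.range (n + 1), (-1 : ℝ) ^ k * (n.choose k : ℝ) * (t + k) ^ i
        = (-1) ^ n * (n.factorial : ℝ)) := by
  have key : ∑ k ∈ Finset.range (n + 1), (-1 : ℝ) ^ k * (n.choose k : ℝ) * (t + k) ^ i
      = (-1) ^ n * (fwdDiff (1 : ℝ))^[n] (fun r : ℝ => r ^ i) t := by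
    rw [fwdDiff_iter_eq_sum_shift, Finset.mul_sum]
    refine Finset.sum_congr rfl fun k hk => ?_
    have hk' : k ≤ n := Nat.lt_succ_iff.mp (Finset.mem_range.mp hk)
    obtain ⟨m, rfl⟩ := Nat.exists_eq_add_of_le hk'
    have h1 : (-1 : ℝ) ^ m * (-1) ^ m = 1 := by
      rw [← mul_pow]; norm_num
    rw [Nat.add_sub_cancel_left, zsmul_eq_mul, nsmul_one]
    push_cast
    rw [pow_add]
    linear_combination (-(-1 : ℝ) ^ k * ((k + m).choose k : ℝ) * (t + k) ^ i) * h1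
  rw [key]
  refine ⟨fun h => ?_, fun h => ?_⟩
  · rw [fwdDiff_iter_pow_eq_zero_of_lt h]; simp
  · subst h
    rw [fwdDiff_iter_eq_factorial]; simp
end
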